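/- arXiv:2605.11407 — 7 statements merged into one kernel-verified Lean document; each statement's English description precedes it below -/
import Mathlib

section
/- Let D be a digraph on a finite vertex type V. Define the split digraph D' on V × Bool with arcs (v, false) → (v, true) for every v ∈ V, and (u, true) → (v, false) whenever D has an arc u → v (the 'splitting operation'). Then a set S ⊆ V is a feedback vertex set of D if and only if the arc set F = {((v, false), (v, true)) : v ∈ S} is a feedback arc set of D'. -/
/-- A directed walk of arcs leaving the complement of `S`, ending outside `S`, stays outside `S`. -/
theorem transGen_avoid_of_transGen_source {V : Type*} {D : V → V → Prop} {S : Set V} {a b : V}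
    (h : Relation.TransGen (fun u v => D u v ∧ u ∉ S) a b) (hb : b ∉ S) :
    Relation.TransGen (fun u v => D u v ∧ u ∉ S ∧ v ∉ S) a b := by
  induction h with
  | single h => exact .single ⟨h.1, h.2, hb⟩
  | tail _ h ih => exact (ih h.2).tail ⟨h.1, h.2, hb⟩


/-- The splitting operation: `S` is a feedback vertex set of a digraph `D` iff the arc
set `{((v,false),(v,true)) : v ∈ S}` is a feedback arc set of the split digraph `D'`
on `V × Bool`, whose arcs are `(v,false) → (v,true)` for every `v`, and
`(u,true) → (v,false)` whenever `D u v`. -/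
theorem stmt_1 {V : Type*} [Fintype V] (D : V → V → Prop) (S : Set V) :
    let D' : V × Bool → V × Bool → Prop := fun p q =>
      (p.2 = false ∧ q.2 = true ∧ p.1 = q.1) ∨ (p.2 = true ∧ q.2 = false ∧ D p.1 q.1)
    let F : Set ((V × Bool) × (V × Bool)) := {x | ∃ v ∈ S, x = ((v, false), (v, true))}
    ((∀ w : V, ¬ Relation.TransGen (fun u v => D u v ∧ u ∉ S ∧ v ∉ S) w w) ↔
      (∀ w : V × Bool,
        ¬ Relation.TransGen (fun p q => D' p q ∧ (p, q) ∉ F) w w)) := by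
  intro D' F
  have vertex_arc {v : V} (hv : v ∉ S) :
      D' (v, false) (v, true) ∧ ((v, false), (v, true)) ∉ F := by
    refine ⟨.inl ⟨rfl, rfl, rfl⟩, ?_⟩
    rintro ⟨x, hx, h⟩
    simp only [Prod.mk.injEq, and_true, and_self] at h
    exact hv (h ▸ hx)
  have digraph_arc {u v : V} (h : D u v) :
      D' (u, true) (v, false) ∧ ((u, true), (v, false)) ∉ F :=
    ⟨.inr ⟨rfl, rfl, h⟩, by rintro ⟨x, -, h⟩; simp at h⟩
  constructor
  · intro hS
    have walk_from_false (v : V) (q : V × Bool)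
        (h : Relation.TransGen (fun p q => D' p q ∧ (p, q) ∉ F) (v, false) q) :
        (q.2 = false → Relation.TransGen (fun u v => D u v ∧ u ∉ S) v q.1) ∧
        (q.2 = true → Relation.ReflTransGen (fun u v => D u v ∧ u ∉ S) v q.1 ∧ q.1 ∉ S) := by
      induction h with
      | @single q h =>
        obtain ⟨y, b⟩ := q
        obtain ⟨⟨-, rfl, rfl⟩ | ⟨h, -⟩, hF⟩ := h
        · exact ⟨nofun, fun _ => ⟨.refl, fun hv => hF ⟨v, hv, rfl⟩⟩⟩
        · cases h
      | @tail p q _ h ih =>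
        obtain ⟨x, a⟩ := p
        obtain ⟨y, b⟩ := q
        obtain ⟨⟨rfl, rfl, rfl⟩ | ⟨rfl, rfl, h⟩, hF⟩ := h
        · exact ⟨nofun, fun _ => ⟨(ih.1 rfl).to_reflTransGen, fun hx => hF ⟨x, hx, rfl⟩⟩⟩
        · exact ⟨fun _ => .tail' (ih.2 rfl).1 ⟨h, (ih.2 rfl).2⟩, nofun⟩
    have no_cycle_false (v : V) :
        ¬ Relation.TransGen (fun p q => D' p q ∧ (p, q) ∉ F) (v, false) (v, false) := by
      intro h
      have hv := (walk_from_false v _ h).1 rfl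
      obtain ⟨_, ⟨-, hvS⟩, -⟩ := Relation.TransGen.head'_iff.1 hv
      exact hS v (transGen_avoid_of_transGen_source hv hvS)
    rintro ⟨w, _ | _⟩ h
    · exact no_cycle_false w h
    · obtain ⟨⟨v, b⟩, hwv, hvw⟩ := Relation.TransGen.head'_iff.1 h
      obtain ⟨⟨h, -⟩ | ⟨-, rfl, -⟩, -⟩ := id hwv
      · cases h
      · exact no_cycle_false v (.tail' hvw hwv)
  · intro hF w h
    refine hF (w, false) (Relation.TransGen.lift' (fun v => (v, false)) ?_ w w h)
    rintro u v ⟨huv, hu, -⟩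
    exact .tail (.single (vertex_arc hu)) (digraph_arc huv)
end

section
/- Let D be a digraph on a finite vertex type V in which every vertex v has either indegree at most one or outdegree at most one (i.e., min{d⁻(v), d⁺(v)} ≤ 1 for all v). Then the minimum cardinality of a feedback vertex set of D equals the minimum cardinality of a feedback arc set of D. -/
/-- A walk extendable at both ends only visits vertices having an incoming and an outgoing arc. -/
theorem transGen_restrict_of_in_out {V : Type*} {R : V → V → Prop} {P : V → Prop}
    (hP : ∀ u v w, R u v → R v w → P v) {a b : V} (hab : Relation.TransGen R a b)
    (ha : ∃ c, R c a) (hb : ∃ c, R b c) :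
    Relation.TransGen (fun u v => R u v ∧ P u ∧ P v) a b := by
  obtain ⟨z, hz⟩ := ha
  induction hab with
  | single hR =>
    obtain ⟨c, hc⟩ := hb
    exact .single ⟨hR, hP _ _ _ hz hR, hP _ _ _ hR hc⟩
  | tail hab hR ih =>
    obtain ⟨c, hc⟩ := hb
    obtain ⟨d, -, hd⟩ := Relation.TransGen.tail'_iff.1 hab
    exact (ih ⟨_, hR⟩).tail ⟨hR, hP _ _ _ hd hR, hP _ _ _ hR hc⟩

/-- If every vertex has indegree or outdegree at most one, a feedback vertex set yields a feedback
arc set that is no larger. -/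
theorem exists_feedbackArcSet_ncard_le {V : Type*} [Finite V] {D : V → V → Prop}
    (h : ∀ v : V, min (Nat.card {u : V // D u v}) (Nat.card {u : V // D v u}) ≤ 1) {S : Set V}
    (hS : ∀ w : V, ¬ Relation.TransGen (fun u v => D u v ∧ u ∉ S ∧ v ∉ S) w w) :
    ∃ F : Set (V × V), (∀ p ∈ F, D p.1 p.2) ∧
      (∀ w : V, ¬ Relation.TransGen (fun u v => D u v ∧ (u, v) ∉ F) w w) ∧
      F.ncard ≤ S.ncard := by
  have key : ∀ v : V, ∃ p : V × V, (∀ u, D u v → p = (u, v)) ∨ (∀ u, D v u → p = (v, u)) := by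
    intro v
    rcases min_le_iff.1 (h v) with h1 | h1
    · have := Finite.card_le_one_iff_subsingleton.1 h1
      by_cases hu : ∃ u, D u v
      · obtain ⟨u, hu⟩ := hu
        refine ⟨(u, v), .inl fun x hx => ?_⟩
        obtain rfl : u = x := congrArg Subtype.val
          (Subsingleton.elim (⟨u, hu⟩ : {u : V // D u v}) ⟨x, hx⟩)
        rfl
      · exact ⟨(v, v), .inl fun x hx => (hu ⟨x, hx⟩).elim⟩
    · have := Finite.card_le_one_iff_subsingleton.1 h1
      by_cases hu : ∃ u, D v u
      · obtain ⟨u, hu⟩ := hu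
        refine ⟨(v, u), .inr fun x hx => ?_⟩
        obtain rfl : u = x := congrArg Subtype.val
          (Subsingleton.elim (⟨u, hu⟩ : {u : V // D v u}) ⟨x, hx⟩)
        rfl
      · exact ⟨(v, v), .inr fun x hx => (hu ⟨x, hx⟩).elim⟩
  choose f hf using key
  refine ⟨{p | D p.1 p.2 ∧ p ∈ f '' S}, fun p hp => hp.1, fun w hw => ?_, ?_⟩
  · obtain ⟨y, hy, -⟩ := Relation.TransGen.head'_iff.1 hw
    obtain ⟨x, -, hx⟩ := Relation.TransGen.tail'_iff.1 hw
    refine hS w (Relation.TransGen.mono (fun u v huv => ⟨huv.1.1, huv.2⟩) _ _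
      (transGen_restrict_of_in_out (P := (· ∉ S)) ?_ hw ⟨x, hx⟩ ⟨y, hy⟩))
    intro u v t huv hvt hv
    rcases hf v with h1 | h1
    · exact huv.2 ⟨huv.1, v, hv, h1 u huv.1⟩
    · exact hvt.2 ⟨hvt.1, v, hv, h1 t hvt.1⟩
  · exact (Set.ncard_le_ncard (fun p hp => hp.2) (Set.toFinite _)).trans
      (Set.ncard_image_le (Set.toFinite _))

/-- The tails of the arcs of a feedback arc set form a feedback vertex set. -/
theorem not_transGen_of_feedbackArcSet {V : Type*} {D : V → V → Prop} {F : Set (V × V)}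
    (hF : ∀ w : V, ¬ Relation.TransGen (fun u v => D u v ∧ (u, v) ∉ F) w w) (w : V) :
    ¬ Relation.TransGen
      (fun u v => D u v ∧ u ∉ Prod.fst '' F ∧ v ∉ Prod.fst '' F) w w :=
  fun hw => hF w (Relation.TransGen.mono
    (fun _ _ huv => ⟨huv.1, fun hmem => huv.2.1 ⟨_, hmem, rfl⟩⟩) _ _ hw)

/-- If every vertex of a digraph `D` has indegree at most one or outdegree at most one,
then the minimum cardinality of a feedback vertex set of `D` equals the minimum
cardinality of a feedback arc set of `D`. -/
theorem stmt_8 {V : Type*} [Fintype V] (D : V → V → Prop)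
    (h : ∀ v : V, min (Nat.card {u : V // D u v}) (Nat.card {u : V // D v u}) ≤ 1) :
    sInf {k | ∃ S : Set V,
        (∀ w : V, ¬ Relation.TransGen (fun u v => D u v ∧ u ∉ S ∧ v ∉ S) w w) ∧ S.ncard = k}
      = sInf {k | ∃ F : Set (V × V), (∀ p ∈ F, D p.1 p.2) ∧
        (∀ w : V, ¬ Relation.TransGen (fun u v => D u v ∧ (u, v) ∉ F) w w) ∧ F.ncard = k} := by
  apply le_antisymm
  · refine le_csInf ⟨_, {p | D p.1 p.2}, fun p hp => hp, fun w hw => ?_, rfl⟩ ?_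
    · obtain ⟨y, hy, -⟩ := Relation.TransGen.head'_iff.1 hw
      exact hy.2 hy.1
    · rintro _ ⟨F, -, hF, rfl⟩
      exact le_trans (Nat.sInf_le ⟨Prod.fst '' F, not_transGen_of_feedbackArcSet hF, rfl⟩)
        (Set.ncard_image_le (Set.toFinite _))
  · refine le_csInf ⟨_, Set.univ, fun w hw => ?_, rfl⟩ ?_
    · obtain ⟨y, hy, -⟩ := Relation.TransGen.head'_iff.1 hw
      exact hy.2.1 trivial
    · rintro _ ⟨S, hS, rfl⟩
      obtain ⟨F, hFD, hF, hle⟩ := exists_feedbackArcSet_ncard_le h hS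
      exact le_trans (Nat.sInf_le ⟨F, hFD, hF, rfl⟩) hle
end

section
/- Let D be a digraph on a finite vertex type V in which every vertex has indegree at least one and outdegree at least one, and let D' be its path-split digraph (with respect to fixed enumerations of the in-neighbors and out-neighbors of each vertex). Then a set S ⊆ V is a feedback vertex set of D if and only if S' = {v⁺₁ : v ∈ S} is a feedback vertex set of D'. -/
/-- A path all of whose arcs have their tail outside `S`, and whose endpoint is also outside `S`,
is a path avoiding `S`. -/
theorem transGen_avoiding_of_tail_notMem {V : Type*} {D : V → V → Prop} {S : Set V} {u v : V}
    (h : Relation.TransGen (fun a b => D a b ∧ a ∉ S) u v) (hv : v ∉ S) :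
    Relation.TransGen (fun a b => D a b ∧ a ∉ S ∧ b ∉ S) u v := by
  induction h with
  | single h => exact .single ⟨h.1, h.2, hv⟩
  | tail _ hbc ih => exact (ih hbc.2).tail ⟨hbc.1, hbc.2, hv⟩

/-- A cycle all of whose arcs have their tail outside `S` avoids `S`. -/
theorem transGen_avoiding_of_tail_notMem_self {V : Type*} {D : V → V → Prop} {S : Set V} {w : V}
    (h : Relation.TransGen (fun a b => D a b ∧ a ∉ S) w w) :
    Relation.TransGen (fun a b => D a b ∧ a ∉ S ∧ b ∉ S) w w := by
  obtain ⟨_, hw, _⟩ := Relation.TransGen.head'_iff.mp h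
  exact transGen_avoiding_of_tail_notMem h hw.2

/-- The path-split reduction for the feedback vertex set problem: `S` is a feedback
vertex set of `D` iff `S' = {v⁺₁ : v ∈ S}` is a feedback vertex set of the path-split
digraph `D'` of `D` (with respect to fixed enumerations of in- and out-neighbors). -/
theorem stmt_9 {V : Type*} [Fintype V] (D : V → V → Prop)
    (din dout : V → ℕ)
    (hdin : ∀ v : V, din v = Nat.card {u : V // D u v})
    (hdout : ∀ v : V, dout v = Nat.card {u : V // D v u})
    (hpos : ∀ v : V, 1 ≤ din v ∧ 1 ≤ dout v)
    (inEnum : ∀ v : V, Fin (din v) ≃ {u : V // D u v})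
    (outEnum : ∀ v : V, Fin (dout v) ≃ {u : V // D v u})
    (S : Set V) :
    let W := Σ v : V, (Fin (din v) ⊕ Fin (dout v))
    let D' : W → W → Prop := fun p q =>
      (∃ (v : V) (i j : Fin (din v)),
        p = ⟨v, Sum.inl i⟩ ∧ q = ⟨v, Sum.inl j⟩ ∧ (j : ℕ) = (i : ℕ) + 1) ∨
      (∃ (v : V) (i : Fin (din v)) (j : Fin (dout v)),
        p = ⟨v, Sum.inl i⟩ ∧ q = ⟨v, Sum.inr j⟩ ∧ (i : ℕ) = din v - 1 ∧ (j : ℕ) = 0) ∨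
      (∃ (v : V) (i j : Fin (dout v)),
        p = ⟨v, Sum.inr i⟩ ∧ q = ⟨v, Sum.inr j⟩ ∧ (j : ℕ) = (i : ℕ) + 1) ∨
      (∃ (u v : V) (j : Fin (dout u)) (i : Fin (din v)),
        p = ⟨u, Sum.inr j⟩ ∧ q = ⟨v, Sum.inl i⟩ ∧
        ((outEnum u j : V) = v) ∧ ((inEnum v i : V) = u))
    let S' : Set W := {p | p.1 ∈ S ∧ ∃ j : Fin (dout p.1), p.2 = Sum.inr j ∧ (j : ℕ) = 0}
    ((∀ w : V, ¬ Relation.TransGen (fun u v => D u v ∧ u ∉ S ∧ v ∉ S) w w) ↔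
      (∀ w : W, ¬ Relation.TransGen (fun p q => D' p q ∧ p ∉ S' ∧ q ∉ S') w w)) := by
  intro W D' S'
  constructor
  · intro hD w hw
    let rank : W → ℕ := fun p => Sum.elim Fin.val (fun j => din p.1 + j.val) p.2
    let stranded : W → Prop := fun p => p.1 ∈ S ∧ p.2.isRight
    let lt : W → W → Prop := fun p q => p.1 = q.1 ∧ rank p < rank q
    let F : V → V → Prop := fun a b => D a b ∧ a ∉ S
    let M : W → W → Prop := fun p q =>
      (stranded q → stranded p ∧ lt p q) ∧
      (¬ stranded p → lt p q ∨ Relation.TransGen F p.1 q.1)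
    have lt_trans : ∀ {p q r}, lt p q → lt q r → lt p r := fun h h' =>
      ⟨h.1.trans h'.1, h.2.trans h'.2⟩
    have : IsTrans W M := by
      refine ⟨fun p q r hpq hqr => ?_⟩
      refine ⟨fun hr => ?_, fun hp => ?_⟩
      · obtain ⟨hq, hlt⟩ := hqr.1 hr
        exact ⟨(hpq.1 hq).1, lt_trans (hpq.1 hq).2 hlt⟩
      · rcases hpq.2 hp with h | h <;> rcases hqr.2 (fun hq => hp (hpq.1 hq).1) with h' | h'
        · exact .inl (lt_trans h h')
        · exact .inr (h.1 ▸ h')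
        · exact .inr (h'.1 ▸ h)
        · exact .inr (h.trans h')
    have M_step : ∀ p q, D' p q ∧ p ∉ S' ∧ q ∉ S' → M p q := by
      rintro p q ⟨h, hp, hq⟩
      rcases h with ⟨v, i, j, rfl, rfl, hij⟩ | ⟨v, i, j, rfl, rfl, hi, hj⟩ |
        ⟨v, i, j, rfl, rfl, hij⟩ | ⟨u, v, j, i, rfl, rfl, hj, hi⟩
      · exact ⟨fun h => by simp [stranded] at h, fun _ => .inl ⟨rfl, by simp [rank]; omega⟩⟩
      · exact ⟨fun h => (hq ⟨h.1, j, rfl, hj⟩).elim,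
          fun _ => .inl ⟨rfl, by simp [rank]; omega⟩⟩
      · have hlt : lt ⟨v, Sum.inr i⟩ ⟨v, Sum.inr j⟩ := ⟨rfl, by simp [rank]; omega⟩
        exact ⟨fun h => ⟨⟨h.1, rfl⟩, hlt⟩, fun _ => .inl hlt⟩
      · refine ⟨fun h => by simp [stranded] at h,
          fun h => .inr (.single ⟨?_, fun hu => h ⟨hu, rfl⟩⟩)⟩
        exact hj ▸ (outEnum u j).2
    have hM : M w w := Relation.transGen_minimal M_step _ _ hw
    have hns : ¬ stranded w := fun h => lt_irrefl _ (hM.1 h).2.2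
    rcases hM.2 hns with h | h
    · exact lt_irrefl _ h.2
    · exact hD _ (transGen_avoiding_of_tail_notMem_self h)
  · intro hD' w hw
    let R : W → W → Prop := fun p q => D' p q ∧ p ∉ S' ∧ q ∉ S'
    have step : ∀ {p q : W}, D' p q → p.1 ∉ S → q.1 ∉ S → R p q := fun h hp hq =>
      ⟨h, fun h' => hp h'.1, fun h' => hq h'.1⟩
    have out_path : ∀ v, v ∉ S → ∀ n (hn : n < dout v), Relation.ReflTransGen R
        ⟨v, Sum.inr ⟨0, (hpos v).2⟩⟩ ⟨v, Sum.inr ⟨n, hn⟩⟩ := by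
      intro v hv n
      induction n with
      | zero => exact fun _ => .refl
      | succ n ih =>
        exact fun hn => (ih (by omega)).tail
          (step (.inr (.inr (.inl ⟨v, _, _, rfl, rfl, rfl⟩))) hv hv)
    have in_path : ∀ v, v ∉ S → ∀ m (hm : m < din v) n, m ≤ n → ∀ hn : n < din v,
        Relation.ReflTransGen R ⟨v, Sum.inl ⟨m, hm⟩⟩ ⟨v, Sum.inl ⟨n, hn⟩⟩ := by
      intro v hv m hm n hmn
      induction n, hmn using Nat.le_induction with
      | base => exact fun _ => .refl
      | succ n _ ih =>
        exact fun hn => (ih (by omega)).tail (step (.inl ⟨v, _, _, rfl, rfl, rfl⟩) hv hv)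
    refine hD' ⟨w, Sum.inr ⟨0, (hpos w).2⟩⟩
      (Relation.TransGen.lift' (p := R) (fun v => (⟨v, Sum.inr ⟨0, (hpos v).2⟩⟩ : W)) ?_ _ _ hw)
    rintro u v ⟨huv, hu, hv⟩
    let j := (outEnum u).symm ⟨v, huv⟩
    let i := (inEnum v).symm ⟨u, huv⟩
    have cross : R ⟨u, Sum.inr j⟩ ⟨v, Sum.inl i⟩ :=
      step (.inr (.inr (.inr ⟨u, v, j, i, rfl, rfl, by simp [j], by simp [i]⟩))) hu hv
    have hv_pos := (hpos v).1
    have hlast : din v - 1 < din v := by omega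
    exact .tail' ((out_path u hu j j.2).trans
        (.head cross (in_path v hv i i.2 (din v - 1) (by omega) hlast)))
      (step (.inr (.inl ⟨v, _, _, rfl, rfl, rfl, rfl⟩)) hv hv)
end

section
/- Let D be a digraph on a finite vertex type V in which every vertex has indegree at least one and outdegree at least one, and let D' be its path-split digraph (with respect to fixed enumerations of the in-neighbors and out-neighbors of each vertex). Then a set S ⊆ V is a feedback vertex set of D if and only if the arc set {(v⁻_{d⁻(v)}, v⁺₁) : v ∈ S} is a feedback arc set of D'. -/
/-- A closed walk all of whose arc heads avoid `S` also has all its arc tails outside `S`. -/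
theorem transGen_avoid_of_transGen_head_avoid {V : Type*} {D : V → V → Prop} {S : Set V} {a : V}
    (h : Relation.TransGen (fun u v => D u v ∧ v ∉ S) a a) :
    Relation.TransGen (fun u v => D u v ∧ u ∉ S ∧ v ∉ S) a a := by
  have head_notMem : ∀ {b c : V}, Relation.TransGen (fun u v => D u v ∧ v ∉ S) b c → c ∉ S := by
    intro b c hbc
    cases hbc with
    | single h => exact h.2
    | tail _ h => exact h.2
  have ha : a ∉ S := head_notMem h
  have key : ∀ c : V, Relation.TransGen (fun u v => D u v ∧ v ∉ S) a c →
      Relation.TransGen (fun u v => D u v ∧ u ∉ S ∧ v ∉ S) a c := by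
    intro c hc
    induction hc with
    | single h => exact .single ⟨h.1, ha, h.2⟩
    | tail hb h ih => exact ih.tail ⟨h.1, head_notMem hb, h.2⟩
  exact key a h

/-- The path-split reduction for the feedback arc set problem: `S` is a feedback vertex
set of `D` iff the arc set `{(v⁻_{d⁻(v)}, v⁺₁) : v ∈ S}` is a feedback arc set of the
path-split digraph `D'` of `D` (with respect to fixed enumerations of in- and
out-neighbors). -/
theorem stmt_10 {V : Type*} [Fintype V] (D : V → V → Prop)
    (din dout : V → ℕ)
    (hdin : ∀ v : V, din v = Nat.card {u : V // D u v})
    (hdout : ∀ v : V, dout v = Nat.card {u : V // D v u})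
    (hpos : ∀ v : V, 1 ≤ din v ∧ 1 ≤ dout v)
    (inEnum : ∀ v : V, Fin (din v) ≃ {u : V // D u v})
    (outEnum : ∀ v : V, Fin (dout v) ≃ {u : V // D v u})
    (S : Set V) :
    let W := Σ v : V, (Fin (din v) ⊕ Fin (dout v))
    let D' : W → W → Prop := fun p q =>
      (∃ (v : V) (i j : Fin (din v)),
        p = ⟨v, Sum.inl i⟩ ∧ q = ⟨v, Sum.inl j⟩ ∧ (j : ℕ) = (i : ℕ) + 1) ∨
      (∃ (v : V) (i : Fin (din v)) (j : Fin (dout v)),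
        p = ⟨v, Sum.inl i⟩ ∧ q = ⟨v, Sum.inr j⟩ ∧ (i : ℕ) = din v - 1 ∧ (j : ℕ) = 0) ∨
      (∃ (v : V) (i j : Fin (dout v)),
        p = ⟨v, Sum.inr i⟩ ∧ q = ⟨v, Sum.inr j⟩ ∧ (j : ℕ) = (i : ℕ) + 1) ∨
      (∃ (u v : V) (j : Fin (dout u)) (i : Fin (din v)),
        p = ⟨u, Sum.inr j⟩ ∧ q = ⟨v, Sum.inl i⟩ ∧
        ((outEnum u j : V) = v) ∧ ((inEnum v i : V) = u))
    let F : Set (W × W) := {x | ∃ v ∈ S, ∃ (i : Fin (din v)) (j : Fin (dout v)),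
      (i : ℕ) = din v - 1 ∧ (j : ℕ) = 0 ∧ x = (⟨v, Sum.inl i⟩, ⟨v, Sum.inr j⟩)}
    ((∀ w : V, ¬ Relation.TransGen (fun u v => D u v ∧ u ∉ S ∧ v ∉ S) w w) ↔
      (∀ w : W, ¬ Relation.TransGen (fun p q => D' p q ∧ (p, q) ∉ F) w w)) := by
  intro W D' F
  set R : W → W → Prop := fun p q => D' p q ∧ (p, q) ∉ F with hR
  have arc_in : ∀ (v : V) (i j : Fin (din v)), (j : ℕ) = i + 1 →
      R ⟨v, Sum.inl i⟩ ⟨v, Sum.inl j⟩ := by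
    intro v i j h
    refine ⟨Or.inl ⟨v, i, j, rfl, rfl, h⟩, ?_⟩
    rintro ⟨x, -, i', j', -, -, h⟩
    have h2 := (Prod.mk.inj h).2
    cases h2
  have arc_mid : ∀ (v : V) (i : Fin (din v)) (j : Fin (dout v)), v ∉ S → (i : ℕ) = din v - 1 →
      (j : ℕ) = 0 → R ⟨v, Sum.inl i⟩ ⟨v, Sum.inr j⟩ := by
    intro v i j hv hi hj
    refine ⟨Or.inr (Or.inl ⟨v, i, j, rfl, rfl, hi, hj⟩), ?_⟩
    rintro ⟨x, hx, i', j', -, -, h⟩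
    have hvx : v = x := congrArg (fun z : W × W => z.1.1) h
    exact hv (hvx ▸ hx)
  have arc_out : ∀ (v : V) (i j : Fin (dout v)), (j : ℕ) = i + 1 →
      R ⟨v, Sum.inr i⟩ ⟨v, Sum.inr j⟩ := by
    intro v i j h
    refine ⟨Or.inr (Or.inr (Or.inl ⟨v, i, j, rfl, rfl, h⟩)), ?_⟩
    rintro ⟨x, -, i', j', -, -, h⟩
    have h1 := (Prod.mk.inj h).1
    cases h1
  have arc_cross : ∀ (u v : V) (j : Fin (dout u)) (i : Fin (din v)), (outEnum u j : V) = v →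
      (inEnum v i : V) = u → R ⟨u, Sum.inr j⟩ ⟨v, Sum.inl i⟩ := by
    intro u v j i hj hi
    refine ⟨Or.inr (Or.inr (Or.inr ⟨u, v, j, i, rfl, rfl, hj, hi⟩)), ?_⟩
    rintro ⟨x, -, i', j', -, -, h⟩
    have h1 := (Prod.mk.inj h).1
    cases h1
  have path_in : ∀ (v : V) (i : Fin (din v)) (k : ℕ) (hk : i + k < din v),
      Relation.ReflTransGen R ⟨v, Sum.inl i⟩ ⟨v, Sum.inl ⟨i + k, hk⟩⟩ := by
    intro v i k
    induction k with
    | zero => intro hk; exact .refl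
    | succ k ih => intro hk; exact (ih (by omega)).tail (arc_in _ _ _ rfl)
  have path_out : ∀ (v : V) (k : ℕ) (hk : k < dout v),
      Relation.ReflTransGen R ⟨v, Sum.inr ⟨0, (hpos v).2⟩⟩ ⟨v, Sum.inr ⟨k, hk⟩⟩ := by
    intro v k
    induction k with
    | zero => intro hk; exact .refl
    | succ k ih => intro hk; exact (ih (by omega)).tail (arc_out _ _ _ rfl)
  constructor
  · intro hD
    have no_cycle_inr : ∀ (a : V) (j : Fin (dout a)),
        ¬ Relation.TransGen R ⟨a, Sum.inr j⟩ ⟨a, Sum.inr j⟩ := by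
      intro a j₀ hcyc
      let G : V → V → Prop := fun u v => D u v ∧ v ∉ S
      let Inv : W → Prop := fun q => match q with
        | ⟨v, Sum.inl _⟩ => ∃ u, Relation.ReflTransGen G a u ∧ D u v
        | ⟨v, Sum.inr j⟩ => (v = a ∧ (j₀ : ℕ) < j) ∨ Relation.TransGen G a v
      have step_cross : ∀ (u v : V) (j : Fin (dout u)), (outEnum u j : V) = v → D u v := by
        rintro u v j rfl
        exact (outEnum u j).2
      have key : ∀ q, Relation.TransGen R ⟨a, Sum.inr j₀⟩ q → Inv q := by
        intro q hq
        induction hq with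
        | single h =>
          rcases h.1 with ⟨v, i, j, hp, rfl, hij⟩ | ⟨v, i, j, hp, rfl, hi, hj⟩ |
            ⟨v, i, j, hp, rfl, hij⟩ | ⟨u, v, j, i, hp, rfl, hj, hi⟩
          · cases hp
          · cases hp
          · cases hp
            exact Or.inl ⟨rfl, by omega⟩
          · cases hp
            exact ⟨a, .refl, step_cross _ _ _ hj⟩
        | tail _ h ih =>
          obtain ⟨h, hF⟩ := h
          rcases h with ⟨v, i, j, rfl, rfl, hij⟩ | ⟨v, i, j, rfl, rfl, hi, hj⟩ |
            ⟨v, i, j, rfl, rfl, hij⟩ | ⟨u, v, j, i, rfl, rfl, hj, hi⟩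
          · exact ih
          · obtain ⟨u, hu, huv⟩ := ih
            exact Or.inr (.tail' hu ⟨huv, fun hv => hF ⟨v, hv, i, j, hi, hj, rfl⟩⟩)
          · rcases ih with ⟨hv, hlt⟩ | ih
            · exact Or.inl ⟨hv, by omega⟩
            · exact Or.inr ih
          · refine ⟨u, ?_, step_cross _ _ _ hj⟩
            rcases ih with ⟨rfl, -⟩ | ih
            · exact .refl
            · exact ih.to_reflTransGen
      rcases key _ hcyc with ⟨-, h⟩ | h
      · exact lt_irrefl _ h
      · exact hD a (transGen_avoid_of_transGen_head_avoid h)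
    rintro ⟨a, i₀ | j₀⟩ hcyc
    · have key : ∀ q, Relation.TransGen R ⟨a, Sum.inl i₀⟩ q →
          (∃ i : Fin (din a), q = ⟨a, Sum.inl i⟩ ∧ (i₀ : ℕ) < i) ∨
          ∃ (v : V) (j : Fin (dout v)), Relation.TransGen R ⟨a, Sum.inl i₀⟩ ⟨v, Sum.inr j⟩ ∧
            Relation.ReflTransGen R ⟨v, Sum.inr j⟩ q := by
        intro q hq
        induction hq with
        | single h =>
          rcases id h.1 with ⟨v, i, j, hp, rfl, hij⟩ | ⟨v, i, j, hp, rfl, hi, hj⟩ |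
            ⟨v, i, j, hp, rfl, hij⟩ | ⟨u, v, j, i, hp, rfl, hj, hi⟩
          · cases hp
            exact Or.inl ⟨j, rfl, by omega⟩
          · exact Or.inr ⟨v, j, .single h, .refl⟩
          · cases hp
          · cases hp
        | tail hb h ih =>
          rcases ih with ⟨i', rfl, hlt⟩ | ⟨v, j, h1, h2⟩
          · rcases id h.1 with ⟨v, i, j, hp, rfl, hij⟩ | ⟨v, i, j, hp, rfl, hi, hj⟩ |
              ⟨v, i, j, hp, rfl, hij⟩ | ⟨u, v, j, i, hp, rfl, hj, hi⟩
            · cases hp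
              exact Or.inl ⟨j, rfl, by omega⟩
            · exact Or.inr ⟨v, j, hb.tail h, .refl⟩
            · cases hp
            · cases hp
          · exact Or.inr ⟨v, j, h1, h2.tail h⟩
      rcases key _ hcyc with ⟨i, h, hlt⟩ | ⟨v, j, h1, h2⟩
      · cases h
        exact lt_irrefl _ hlt
      · exact no_cycle_inr v j (.trans_right h2 h1)
    · exact no_cycle_inr a j₀ hcyc
  · intro hD' w hw
    refine hD' ⟨w, Sum.inr ⟨0, (hpos w).2⟩⟩
      (Relation.TransGen.lift' (fun v => (⟨v, Sum.inr ⟨0, (hpos v).2⟩⟩ : W)) ?_ w w hw)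
    rintro u v ⟨huv, -, hv⟩
    obtain ⟨j, hj⟩ := (outEnum u).surjective ⟨v, huv⟩
    obtain ⟨i, hi⟩ := (inEnum v).surjective ⟨u, huv⟩
    have hlast : (i : ℕ) + (din v - 1 - i) = din v - 1 := by omega
    have hlt : (i : ℕ) + (din v - 1 - i) < din v := by omega
    exact .tail' (((path_out u j j.2).tail (arc_cross u v j i (by rw [hj]) (by rw [hi]))).trans
      (path_in v i _ hlt)) (arc_mid v _ _ hv hlast rfl)
end

section
/- Let D be a digraph on a finite vertex type V in which every vertex has indegree at least one and outdegree at least one, and let D' be its path-split digraph (with respect to fixed enumerations of the in-neighbors and out-neighbors of each vertex). Then every vertex of D' has total degree (indegree plus outdegree) at most three. -/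
/-- Every vertex of the path-split digraph `D'` of a digraph `D` (in which every vertex
has indegree and outdegree at least one) has total degree, i.e. indegree plus
outdegree, at most three. -/
theorem stmt_11 {V : Type*} [Fintype V] (D : V → V → Prop)
    (din dout : V → ℕ)
    (hdin : ∀ v : V, din v = Nat.card {u : V // D u v})
    (hdout : ∀ v : V, dout v = Nat.card {u : V // D v u})
    (hpos : ∀ v : V, 1 ≤ din v ∧ 1 ≤ dout v)
    (inEnum : ∀ v : V, Fin (din v) ≃ {u : V // D u v})
    (outEnum : ∀ v : V, Fin (dout v) ≃ {u : V // D v u}) :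
    let W := Σ v : V, (Fin (din v) ⊕ Fin (dout v))
    let D' : W → W → Prop := fun p q =>
      (∃ (v : V) (i j : Fin (din v)),
        p = ⟨v, Sum.inl i⟩ ∧ q = ⟨v, Sum.inl j⟩ ∧ (j : ℕ) = (i : ℕ) + 1) ∨
      (∃ (v : V) (i : Fin (din v)) (j : Fin (dout v)),
        p = ⟨v, Sum.inl i⟩ ∧ q = ⟨v, Sum.inr j⟩ ∧ (i : ℕ) = din v - 1 ∧ (j : ℕ) = 0) ∨
      (∃ (v : V) (i j : Fin (dout v)),
        p = ⟨v, Sum.inr i⟩ ∧ q = ⟨v, Sum.inr j⟩ ∧ (j : ℕ) = (i : ℕ) + 1) ∨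
      (∃ (u v : V) (j : Fin (dout u)) (i : Fin (din v)),
        p = ⟨u, Sum.inr j⟩ ∧ q = ⟨v, Sum.inl i⟩ ∧
        ((outEnum u j : V) = v) ∧ ((inEnum v i : V) = u))
    ∀ p : W, Nat.card {q : W // D' q p} + Nat.card {q : W // D' p q} ≤ 3 := by
  intro W D'
  have in_unique : ∀ p q q' : W, D' q p → D' q' p → q.2.isLeft = q'.2.isLeft → q = q' := by
    rintro p q q' (⟨v, i, j, rfl, rfl, h⟩ | ⟨v, i, j, rfl, rfl, h, h₀⟩ | ⟨v, i, j, rfl, rfl, h⟩ |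
      ⟨u, v, j, i, rfl, rfl, h, h₀⟩)
      (⟨v', i', j', rfl, e, h'⟩ | ⟨v', i', j', rfl, e, h', h₀'⟩ | ⟨v', i', j', rfl, e, h'⟩ |
      ⟨u', v', j', i', rfl, e, h', h₀'⟩) hside <;> cases e <;>
      first
      | (simp at hside; done)
      | (have hi : i = i' := Fin.ext (by omega)
         rw [hi])
      | (subst h₀ h₀'
         have hj : j = j' := (outEnum _).injective (Subtype.ext (h.trans h'.symm))
         rw [hj])
  have out_unique : ∀ p q q' : W, D' p q → D' p q' → q.2.isLeft = q'.2.isLeft → q = q' := by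
    rintro p q q' (⟨v, i, j, rfl, rfl, h⟩ | ⟨v, i, j, rfl, rfl, h, h₀⟩ | ⟨v, i, j, rfl, rfl, h⟩ |
      ⟨u, v, j, i, rfl, rfl, h, h₀⟩)
      (⟨v', i', j', e, rfl, h'⟩ | ⟨v', i', j', e, rfl, h', h₀'⟩ | ⟨v', i', j', e, rfl, h'⟩ |
      ⟨u', v', j', i', e, rfl, h', h₀'⟩) hside <;> cases e <;>
      first
      | (simp at hside; done)
      | (have hj : j = j' := Fin.ext (by omega)
         rw [hj])
      | (subst h h'
         have hi : i = i' := (inEnum _).injective (Subtype.ext (h₀.trans h₀'.symm))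
         rw [hi])
  have in_le_two : ∀ p : W, Nat.card {q : W // D' q p} ≤ 2 := fun p => by
    simpa using Nat.card_le_card_of_injective (fun q : {q : W // D' q p} => q.1.2.isLeft)
      fun q q' h => Subtype.ext (in_unique p q q' q.2 q'.2 h)
  have out_le_two : ∀ p : W, Nat.card {q : W // D' p q} ≤ 2 := fun p => by
    simpa using Nat.card_le_card_of_injective (fun q : {q : W // D' p q} => q.1.2.isLeft)
      fun q q' h => Subtype.ext (out_unique p q q' q.2 q'.2 h)
  rintro ⟨v, i | j⟩
  · have hout : Nat.card {q : W // D' ⟨v, Sum.inl i⟩ q} ≤ 1 := by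
      refine Finite.card_le_one_iff_subsingleton.mpr ⟨fun ⟨q, hq⟩ ⟨q', hq'⟩ => ?_⟩
      refine Subtype.ext (out_unique _ q q' hq hq' ?_)
      rcases hq with ⟨_, _, k, e, rfl, h⟩ | ⟨_, _, k, e, rfl, h, -⟩ | ⟨_, _, _, e, _⟩ |
          ⟨_, _, _, _, e, _⟩ <;> cases e <;>
        rcases hq' with ⟨_, _, k', e, rfl, h'⟩ | ⟨_, _, k', e, rfl, h', -⟩ | ⟨_, _, _, e, _⟩ |
          ⟨_, _, _, _, e, _⟩ <;> cases e <;>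
        first
        | rfl
        | (exfalso; omega)
    exact Nat.add_le_add (in_le_two _) hout
  · have hin : Nat.card {q : W // D' q ⟨v, Sum.inr j⟩} ≤ 1 := by
      refine Finite.card_le_one_iff_subsingleton.mpr ⟨fun ⟨q, hq⟩ ⟨q', hq'⟩ => ?_⟩
      refine Subtype.ext (in_unique _ q q' hq hq' ?_)
      rcases hq with ⟨_, _, _, _, e, _⟩ | ⟨_, _, _, rfl, e, _, h⟩ | ⟨_, _, _, rfl, e, h⟩ |
          ⟨_, _, _, _, _, e, _⟩ <;> cases e <;>
        rcases hq' with ⟨_, _, _, _, e, _⟩ | ⟨_, _, _, rfl, e, _, h'⟩ | ⟨_, _, _, rfl, e, h'⟩ |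
          ⟨_, _, _, _, _, e, _⟩ <;> cases e <;>
        first
        | rfl
        | (exfalso; omega)
    exact Nat.add_le_add hin (out_le_two _)
end

section
/- Let G be a connected finite simple graph with n vertices, maximum degree at most four, and at least two edges, and let G' be the graph obtained from G by the path-gadget construction (with respect to fixed injective numberings ν_v of the neighbors of each vertex v into {1, 2, 3, 4}). Then, for every natural number k with 1 ≤ k < n, G has a connected vertex cover of cardinality at most k if and only if G' has a connected feedback vertex set of cardinality at most 8k + 8n(k − 1). -/
namespace SimpleGraph

theorem Reachable.of_adj_closed {α : Type*} {H : SimpleGraph α} {P : α → Prop}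
    (hP : ∀ a b, H.Adj a b → P a → P b) {a b : α} (h : H.Reachable a b) (ha : P a) : P b := by
  obtain ⟨p⟩ := h
  induction p with
  | nil => exact ha
  | cons h _ ih => exact ih (hP _ _ h ha)

theorem reachable_of_forall_succ {α : Type*} {H : SimpleGraph α} {m : ℕ} (f : Fin m → α)
    (hf : ∀ i j : Fin m, (j : ℕ) = i + 1 → H.Adj (f i) (f j)) (i j : Fin m) :
    H.Reachable (f i) (f j) := by
  have key : ∀ (d : ℕ) (i j : Fin m), (j : ℕ) = i + d → H.Reachable (f i) (f j) := by
    intro d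
    induction d with
    | zero =>
      intro i j h
      obtain rfl : j = i := Fin.ext (by simpa using h)
      exact Reachable.refl _
    | succ d ih =>
      intro i j h
      have hlt : (i : ℕ) + d < m := by omega
      exact (ih i ⟨i + d, hlt⟩ rfl).trans (hf ⟨i + d, hlt⟩ j (by simp only; omega)).reachable
  rcases le_total (i : ℕ) j with h | h
  · exact key _ i j (Nat.add_sub_of_le h).symm
  · exact (key _ j i (Nat.add_sub_of_le h).symm).symm

/-- A graph is acyclic if its vertices can be ranked so that each vertex has at most one
neighbor that is not ranked above it. -/
theorem isAcyclic_of_rank {α : Type*} {H : SimpleGraph α} (f : α → ℕ)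
    (hf : ∀ a b c, H.Adj a b → H.Adj a c → f b ≤ f a → f c ≤ f a → b = c) : H.IsAcyclic := by
  classical
  intro v p hp
  obtain ⟨u, hu, hmax⟩ := p.support.toFinset.exists_max_image f ⟨v, by simp⟩
  rw [List.mem_toFinset] at hu
  have hc := hp.rotate hu
  have hle : ∀ w ∈ (p.rotate u hu).support, f w ≤ f u := fun w hw =>
    hmax w (by simpa using hw)
  exact hc.snd_ne_penultimate (hf u _ _ (Walk.adj_snd hc.not_nil)
    (Walk.adj_penultimate hc.not_nil).symm
    (hle _ (Walk.getVert_mem_support _ _)) (hle _ (Walk.getVert_mem_support _ _)))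

/-- In a connected graph, every vertex other than the root `r` has a parent closer to `r`. -/
theorem Connected.exists_parent {α : Type*} {H : SimpleGraph α} (hH : H.Connected) (r : α) :
    ∃ p : {a : α // a ≠ r} → α, ∀ a : {a : α // a ≠ r},
      H.Adj a (p a) ∧ H.dist (p a) r < H.dist a r := by
  refine ⟨_, fun a => Classical.choose_spec
    (p := fun b => H.Adj a b ∧ H.dist b r < H.dist a r) ?_⟩
  obtain ⟨a, ha⟩ := a
  obtain ⟨w, hw⟩ := (hH a r).exists_walk_length_eq_dist
  cases w with
  | nil => exact absurd rfl ha
  | cons h q => exact ⟨_, h, by rw [← hw, Walk.length_cons]; exact Nat.lt_succ_of_le (dist_le q)⟩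

/-- The path-gadget graph: a path on eight vertices for every vertex of `G`, and a path on `m`
vertices for every ordered pair of adjacent vertices of `G`, attached according to `nu`. -/
def pathGadget {V : Type*} (G : SimpleGraph V) (nu : ∀ v : V, {x : V // G.Adj v x} → Fin 4)
    (m : ℕ) : SimpleGraph ((V × Fin 8) ⊕ ({p : V × V // G.Adj p.1 p.2} × Fin m)) :=
  SimpleGraph.fromRel (fun a b =>
      (∃ (v : V) (i j : Fin 8),
        a = Sum.inl (v, i) ∧ b = Sum.inl (v, j) ∧ (j : ℕ) = (i : ℕ) + 1) ∨
      (∃ (e : {p : V × V // G.Adj p.1 p.2}) (i j : Fin m),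
        a = Sum.inr (e, i) ∧ b = Sum.inr (e, j) ∧ (j : ℕ) = (i : ℕ) + 1) ∨
      (∃ (v x : V) (h : G.Adj v x) (i : Fin 8) (j : Fin m),
        a = Sum.inl (v, i) ∧ b = Sum.inr (⟨(v, x), h⟩, j) ∧
        (i : ℕ) = 2 * (nu v ⟨x, h⟩ : ℕ) ∧ (j : ℕ) = 0) ∨
      (∃ (v x : V) (h : G.Adj x v) (i : Fin 8) (j : Fin m),
        a = Sum.inl (v, i) ∧ b = Sum.inr (⟨(x, v), h⟩, j) ∧
        (i : ℕ) = 2 * (nu v ⟨x, h.symm⟩ : ℕ) + 1 ∧ (j : ℕ) = m - 1))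

section PathGadget

variable {V : Type*} {G : SimpleGraph V} {nu : ∀ v : V, {x : V // G.Adj v x} → Fin 4} {m : ℕ}

theorem pathGadget_adj_inl_inl {v w : V} {i j : Fin 8} :
    (pathGadget G nu m).Adj (Sum.inl (v, i)) (Sum.inl (w, j)) ↔
      v = w ∧ ((j : ℕ) = i + 1 ∨ (i : ℕ) = j + 1) := by
  simp only [pathGadget, fromRel_adj, Sum.inl.injEq, Prod.mk.injEq, reduceCtorEq, false_and,
    and_false, exists_false, or_false, ne_eq]
  constructor
  · rintro ⟨-, ⟨_, _, _, ⟨rfl, rfl⟩, ⟨rfl, rfl⟩, h⟩ | ⟨_, _, _, ⟨rfl, rfl⟩, ⟨rfl, rfl⟩, h⟩⟩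
    · exact ⟨rfl, Or.inl h⟩
    · exact ⟨rfl, Or.inr h⟩
  · rintro ⟨rfl, h | h⟩
    · exact ⟨by rintro ⟨-, rfl⟩; omega, Or.inl ⟨v, i, j, ⟨rfl, rfl⟩, ⟨rfl, rfl⟩, h⟩⟩
    · exact ⟨by rintro ⟨-, rfl⟩; omega, Or.inr ⟨v, j, i, ⟨rfl, rfl⟩, ⟨rfl, rfl⟩, h⟩⟩

theorem pathGadget_adj_inr_inr {e f : {p : V × V // G.Adj p.1 p.2}} {i j : Fin m} :
    (pathGadget G nu m).Adj (Sum.inr (e, i)) (Sum.inr (f, j)) ↔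
      e = f ∧ ((j : ℕ) = i + 1 ∨ (i : ℕ) = j + 1) := by
  simp only [pathGadget, fromRel_adj, Sum.inr.injEq, Prod.mk.injEq, reduceCtorEq, false_and,
    and_false, exists_false, or_false, false_or, ne_eq]
  constructor
  · rintro ⟨-, ⟨_, _, _, ⟨rfl, rfl⟩, ⟨rfl, rfl⟩, h⟩ | ⟨_, _, _, ⟨rfl, rfl⟩, ⟨rfl, rfl⟩, h⟩⟩
    · exact ⟨rfl, Or.inl h⟩
    · exact ⟨rfl, Or.inr h⟩
  · rintro ⟨rfl, h | h⟩
    · exact ⟨by rintro ⟨-, rfl⟩; omega, Or.inl ⟨e, i, j, ⟨rfl, rfl⟩, ⟨rfl, rfl⟩, h⟩⟩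
    · exact ⟨by rintro ⟨-, rfl⟩; omega, Or.inr ⟨e, j, i, ⟨rfl, rfl⟩, ⟨rfl, rfl⟩, h⟩⟩

theorem pathGadget_adj_inl_inr {v : V} {i : Fin 8} {e : {p : V × V // G.Adj p.1 p.2}}
    {j : Fin m} :
    (pathGadget G nu m).Adj (Sum.inl (v, i)) (Sum.inr (e, j)) ↔
      (v = e.1.1 ∧ (i : ℕ) = 2 * nu e.1.1 ⟨e.1.2, e.2⟩ ∧ (j : ℕ) = 0) ∨
      (v = e.1.2 ∧ (i : ℕ) = 2 * nu e.1.2 ⟨e.1.1, e.2.symm⟩ + 1 ∧ (j : ℕ) = m - 1) := by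
  obtain ⟨⟨a, b⟩, hab⟩ := e
  simp only [pathGadget, fromRel_adj, Sum.inl.injEq, Sum.inr.injEq, Prod.mk.injEq, reduceCtorEq,
    false_and, and_false, exists_false, or_false, false_or, ne_eq, not_false_eq_true, true_and]
  constructor
  · rintro (⟨_, _, _, _, _, ⟨rfl, rfl⟩, ⟨h, rfl⟩, hi, hj⟩ |
      ⟨_, _, _, _, _, ⟨rfl, rfl⟩, ⟨h, rfl⟩, hi, hj⟩) <;> cases h
    · exact Or.inl ⟨rfl, hi, hj⟩
    · exact Or.inr ⟨rfl, hi, hj⟩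
  · rintro (⟨rfl, hi, hj⟩ | ⟨rfl, hi, hj⟩)
    · exact Or.inl ⟨_, _, hab, _, _, ⟨rfl, rfl⟩, ⟨rfl, rfl⟩, hi, hj⟩
    · exact Or.inr ⟨_, _, hab, _, _, ⟨rfl, rfl⟩, ⟨rfl, rfl⟩, hi, hj⟩

theorem pathGadget_adj_inr_inl {v : V} {i : Fin 8} {e : {p : V × V // G.Adj p.1 p.2}}
    {j : Fin m} :
    (pathGadget G nu m).Adj (Sum.inr (e, j)) (Sum.inl (v, i)) ↔
      (v = e.1.1 ∧ (i : ℕ) = 2 * nu e.1.1 ⟨e.1.2, e.2⟩ ∧ (j : ℕ) = 0) ∨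
      (v = e.1.2 ∧ (i : ℕ) = 2 * nu e.1.2 ⟨e.1.1, e.2.symm⟩ + 1 ∧ (j : ℕ) = m - 1) := by
  rw [adj_comm, pathGadget_adj_inl_inr]

theorem isAcyclic_induce_compl_pathGadget {S : Set V} (hS : ∀ u v : V, G.Adj u v → u ∈ S ∨ v ∈ S)
    {S' : Set ((V × Fin 8) ⊕ ({p : V × V // G.Adj p.1 p.2} × Fin m))}
    (hS' : ∀ v ∈ S, ∀ i, Sum.inl (v, i) ∈ S') : ((pathGadget G nu m).induce S'ᶜ).IsAcyclic := by
  classical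
  have hout : ∀ v i, Sum.inl (v, i) ∈ S'ᶜ → v ∉ S := fun v i h hv => h (hS' v hv i)
  apply isAcyclic_of_rank (fun w => Sum.elim (fun p => (p.2 : ℕ))
    (fun q => if q.1.1.1 ∈ S then 8 + (m - 1 - q.2) else 8 + q.2) w.1)
  rintro ⟨⟨u, a⟩ | ⟨e, a⟩, ha⟩ ⟨⟨v, b⟩ | ⟨e', b⟩, hb⟩ ⟨⟨w, c⟩ | ⟨e'', c⟩, hc⟩ hab hac hfb hfc <;>
    simp only [induce_adj, pathGadget_adj_inl_inl, pathGadget_adj_inl_inr,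
    pathGadget_adj_inr_inl, pathGadget_adj_inr_inr, Sum.elim_inl, Sum.elim_inr, Subtype.mk.injEq,
    Sum.inl.injEq, Sum.inr.injEq, reduceCtorEq, Prod.mk.injEq] at hab hac hfb hfc ⊢
  · grind
  · grind
  · grind
  · grind
  · have := hout _ _ hb
    have := hout _ _ hc
    have := hS _ _ e.2
    grind
  · obtain ⟨rfl, hac⟩ := hac
    have := hout _ _ hb
    have := hS _ _ e.2
    grind
  · obtain ⟨rfl, hab⟩ := hab
    have := hout _ _ hc
    have := hS _ _ e.2
    grind
  · obtain ⟨rfl, hab⟩ := hab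
    obtain ⟨rfl, hac⟩ := hac
    split_ifs at hfb hfc <;> grind

/-- A connected vertex cover `S` of `G` yields a connected feedback vertex set of the gadget: take
the paths of the vertices of `S` and the paths of the edges of a spanning tree of `G[S]`. -/
theorem exists_connected_feedback_vertex_set [Finite V] (hm : 0 < m) {S : Set V}
    (hS : ∀ u v : V, G.Adj u v → u ∈ S ∨ v ∈ S) (hconn : (G.induce S).Connected) :
    ∃ S' : Set ((V × Fin 8) ⊕ ({p : V × V // G.Adj p.1 p.2} × Fin m)),
      ((pathGadget G nu m).induce S'ᶜ).IsAcyclic ∧ ((pathGadget G nu m).induce S').Connected ∧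
      S'.ncard ≤ 8 * S.ncard + m * (S.ncard - 1) := by
  classical
  have := Fintype.ofFinite V
  obtain ⟨r⟩ := hconn.nonempty
  obtain ⟨p, hp⟩ := hconn.exists_parent r
  let e : {a : S // a ≠ r} → {p : V × V // G.Adj p.1 p.2} :=
    fun a => ⟨(a.1.1, (p a).1), (hp a).1⟩
  let A : S × Fin 8 → (V × Fin 8) ⊕ ({p : V × V // G.Adj p.1 p.2} × Fin m) :=
    fun x => Sum.inl (x.1.1, x.2)
  let B : {a : S // a ≠ r} × Fin m → (V × Fin 8) ⊕ ({p : V × V // G.Adj p.1 p.2} × Fin m) :=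
    fun x => Sum.inr (e x.1, x.2)
  have hA : ∀ v i, A (v, i) ∈ Set.range A ∪ Set.range B := fun v i => Or.inl ⟨_, rfl⟩
  have hB : ∀ v i, B (v, i) ∈ Set.range A ∪ Set.range B := fun v i => Or.inr ⟨_, rfl⟩
  refine ⟨Set.range A ∪ Set.range B,
    isAcyclic_induce_compl_pathGadget hS (fun v hv i => hA ⟨v, hv⟩ i), ?_, ?_⟩
  · set H := (pathGadget G nu m).induce (Set.range A ∪ Set.range B)
    have hpathA : ∀ v i j, H.Reachable ⟨_, hA v i⟩ ⟨_, hA v j⟩ := fun v =>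
      reachable_of_forall_succ (H := H) (fun i => ⟨_, hA v i⟩) fun i j h =>
        pathGadget_adj_inl_inl.2 ⟨rfl, Or.inl h⟩
    have hpathB : ∀ v i j, H.Reachable ⟨_, hB v i⟩ ⟨_, hB v j⟩ := fun v =>
      reachable_of_forall_succ (H := H) (fun i => ⟨_, hB v i⟩) fun i j h =>
        pathGadget_adj_inr_inr.2 ⟨rfl, Or.inl h⟩
    have hfirst : ∀ (v : {a : S // a ≠ r}) j, H.Reachable ⟨_, hB v j⟩ ⟨_, hA v.1 0⟩ := by
      intro v j
      have hadj : H.Adj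
          ⟨_, hA v.1 ⟨2 * nu v.1 ⟨p v, (hp v).1⟩, by omega⟩⟩ ⟨_, hB v ⟨0, hm⟩⟩ :=
        pathGadget_adj_inl_inr.2 (Or.inl ⟨rfl, rfl, rfl⟩)
      exact (hpathB v _ _).trans (hadj.symm.reachable.trans (hpathA _ _ _))
    have hlast : ∀ (v : {a : S // a ≠ r}) j, H.Reachable ⟨_, hB v j⟩ ⟨_, hA (p v) 0⟩ := by
      intro v j
      have hadj : H.Adj
          ⟨_, hA (p v) ⟨2 * nu (p v) ⟨v.1, (hp v).1.symm⟩ + 1, by omega⟩⟩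
          ⟨_, hB v ⟨m - 1, by omega⟩⟩ :=
        pathGadget_adj_inl_inr.2 (Or.inr ⟨rfl, rfl, rfl⟩)
      exact (hpathB v _ _).trans (hadj.symm.reachable.trans (hpathA _ _ _))
    have hroot : ∀ (d : ℕ) (v : S), (G.induce S).dist v r = d →
        H.Reachable ⟨_, hA v 0⟩ ⟨_, hA r 0⟩ := by
      intro d
      induction d using Nat.strong_induction_on with
      | _ d ih =>
        intro v hv
        by_cases hvr : v = r
        · subst hvr; exact Reachable.refl _
        · exact ((hfirst ⟨v, hvr⟩ ⟨0, hm⟩).symm.trans (hlast _ _)).trans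
            (ih _ (hv ▸ (hp ⟨v, hvr⟩).2) _ rfl)
    refine connected_iff_exists_forall_reachable _ |>.2 ⟨⟨_, hA r 0⟩, ?_⟩
    rintro ⟨_, ⟨⟨v, i⟩, rfl⟩ | ⟨⟨v, j⟩, rfl⟩⟩
    · exact ((hpathA v i 0).trans (hroot _ v rfl)).symm
    · exact ((hfirst v j).trans (hroot _ v.1 rfl)).symm
  · have h1 : (Set.range A).ncard ≤ 8 * S.ncard := by
      rw [← Set.image_univ]
      refine (Set.ncard_image_le (Set.toFinite _)).trans ?_
      rw [Set.ncard_univ, Nat.card_prod, Nat.card_coe_set_eq, Nat.card_fin, mul_comm]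
    have h2 : (Set.range B).ncard ≤ m * (S.ncard - 1) := by
      rw [← Set.image_univ]
      refine (Set.ncard_image_le (Set.toFinite _)).trans ?_
      rw [Set.ncard_univ, Nat.card_prod, Nat.card_fin, mul_comm, Nat.card_eq_fintype_card,
        Fintype.card_subtype_compl, Fintype.card_subtype_eq, ← Nat.card_eq_fintype_card,
        Nat.card_coe_set_eq]
    exact (Set.ncard_union_le _ _).trans (add_le_add h1 h2)

/-- The cycle that the gadget creates for the edge `vx` meets every feedback vertex set. -/
theorem exists_mem_of_isAcyclic_induce_compl_pathGadget (hm : 0 < m)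
    {S' : Set ((V × Fin 8) ⊕ ({p : V × V // G.Adj p.1 p.2} × Fin m))}
    (hac : ((pathGadget G nu m).induce S'ᶜ).IsAcyclic) {v x : V} (h : G.Adj v x) :
    (∃ i, Sum.inl (v, i) ∈ S') ∨ (∃ i, Sum.inl (x, i) ∈ S') ∨
      (∃ j, Sum.inr (⟨(v, x), h⟩, j) ∈ S') ∨ ∃ j, Sum.inr (⟨(x, v), h.symm⟩, j) ∈ S' := by
  by_contra! hcon
  obtain ⟨hv, hx, hvx, hxv⟩ := hcon
  set H := (pathGadget G nu m).induce S'ᶜ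
  let i : Fin 4 := nu v ⟨x, h⟩
  let k : Fin 4 := nu x ⟨v, h.symm⟩
  let a : Fin 8 := ⟨2 * i, by omega⟩
  let b : Fin 8 := ⟨2 * i + 1, by omega⟩
  let c : Fin 8 := ⟨2 * k, by omega⟩
  let d : Fin 8 := ⟨2 * k + 1, by omega⟩
  have hab : H.Adj ⟨_, hv a⟩ ⟨_, hv b⟩ := pathGadget_adj_inl_inl.2 ⟨rfl, Or.inl rfl⟩
  have hbridge := isAcyclic_iff_forall_adj_isBridge.1 hac hab
  rw [isBridge_iff] at hbridge
  apply hbridge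
  have hadj : ∀ p q, H.Adj p q → (p.1 ≠ Sum.inl (v, a) ∧ p.1 ≠ Sum.inl (v, b) ∨
      q.1 ≠ Sum.inl (v, a) ∧ q.1 ≠ Sum.inl (v, b)) →
      (H.deleteEdges {s(⟨_, hv a⟩, ⟨_, hv b⟩)}).Adj p q := by
    rintro ⟨p, _⟩ ⟨q, _⟩ hpq hne
    rw [deleteEdges_adj]
    refine ⟨hpq, ?_⟩
    simp only [Set.mem_singleton_iff, Sym2.eq_iff, Subtype.mk.injEq]
    grind
  set K := H.deleteEdges {s(⟨_, hv a⟩, ⟨_, hv b⟩)}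
  have h1 : K.Adj ⟨_, hv a⟩ ⟨_, hvx ⟨0, hm⟩⟩ :=
    hadj _ _ (pathGadget_adj_inl_inr.2 (Or.inl ⟨rfl, rfl, rfl⟩)) (by simp)
  have h2 : K.Reachable ⟨_, hvx ⟨0, hm⟩⟩ ⟨_, hvx ⟨m - 1, by omega⟩⟩ :=
    reachable_of_forall_succ (H := K) (fun j => ⟨_, hvx j⟩) (fun i j h =>
      hadj ⟨_, hvx i⟩ ⟨_, hvx j⟩ (pathGadget_adj_inr_inr.2 ⟨rfl, Or.inl h⟩) (by simp)) _ _
  have h3 : K.Adj ⟨_, hvx ⟨m - 1, by omega⟩⟩ ⟨_, hx d⟩ :=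
    hadj _ _ (pathGadget_adj_inr_inl.2 (Or.inr ⟨rfl, rfl, rfl⟩)) (by simp)
  have h4 : K.Adj ⟨_, hx d⟩ ⟨_, hx c⟩ :=
    hadj _ _ (pathGadget_adj_inl_inl.2 ⟨rfl, Or.inr rfl⟩) (by simp [h.ne'])
  have h5 : K.Adj ⟨_, hx c⟩ ⟨_, hxv ⟨0, hm⟩⟩ :=
    hadj _ _ (pathGadget_adj_inl_inr.2 (Or.inl ⟨rfl, rfl, rfl⟩)) (by simp)
  have h6 : K.Reachable ⟨_, hxv ⟨0, hm⟩⟩ ⟨_, hxv ⟨m - 1, by omega⟩⟩ :=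
    reachable_of_forall_succ (H := K) (fun j => ⟨_, hxv j⟩) (fun i j h =>
      hadj ⟨_, hxv i⟩ ⟨_, hxv j⟩ (pathGadget_adj_inr_inr.2 ⟨rfl, Or.inl h⟩) (by simp)) _ _
  have h7 : K.Adj ⟨_, hxv ⟨m - 1, by omega⟩⟩ ⟨_, hv b⟩ :=
    hadj _ _ (pathGadget_adj_inr_inl.2 (Or.inr ⟨rfl, rfl, rfl⟩)) (by simp)
  exact h1.reachable.trans (h2.trans (h3.reachable.trans (h4.reachable.trans
    (h5.reachable.trans (h6.trans h7.reachable)))))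

/-- The vertices whose paths meet a connected feedback vertex set of the gadget form a connected
vertex cover of `G`; connecting them takes at least `S.ncard - 1` whole edge paths. -/
theorem exists_connected_vertex_cover [Finite V] (hm : 0 < m) (hedges : 2 ≤ G.edgeSet.ncard)
    {S' : Set ((V × Fin 8) ⊕ ({p : V × V // G.Adj p.1 p.2} × Fin m))}
    (hac : ((pathGadget G nu m).induce S'ᶜ).IsAcyclic)
    (hconn : ((pathGadget G nu m).induce S').Connected) :
    ∃ S : Set V, (∀ u v : V, G.Adj u v → u ∈ S ∨ v ∈ S) ∧ (G.induce S).Connected ∧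
      m * (S.ncard - 1) ≤ S'.ncard := by
  classical
  let S : Set V := {v | ∃ i, Sum.inl (v, i) ∈ S'}
  have hcover : ∀ u v : V, G.Adj u v → u ∈ S ∨ v ∈ S := by
    intro v x h
    by_contra! hcon
    obtain ⟨hv, hx⟩ := hcon
    have hmem : ∃ e : {p : V × V // G.Adj p.1 p.2}, s(e.1.1, e.1.2) = s(v, x) ∧
        ∃ j, Sum.inr (e, j) ∈ S' := by
      rcases exists_mem_of_isAcyclic_induce_compl_pathGadget hm hac h with h' | h' | h' | h'
      · exact absurd h' hv
      · exact absurd h' hx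
      · exact ⟨_, rfl, h'⟩
      · exact ⟨_, Sym2.eq_swap, h'⟩
    obtain ⟨e, he, j, hj⟩ := hmem
    have he1 : e.1.1 ∉ S := by grind
    have he2 : e.1.2 ∉ S := by grind
    have hall : ∀ w : S', ∃ j, w.1 = Sum.inr (e, j) := by
      intro w
      refine (hconn ⟨_, hj⟩ w).of_adj_closed (P := fun w => ∃ j, w.1 = Sum.inr (e, j)) ?_ ⟨j, rfl⟩
      rintro ⟨_, _⟩ ⟨⟨u, i⟩ | ⟨f, i⟩, hb⟩ hab ⟨j, rfl⟩
      · have hu : u ∈ S := ⟨i, hb⟩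
        rcases pathGadget_adj_inr_inl.1 hab with ⟨rfl, -⟩ | ⟨rfl, -⟩ <;> contradiction
      · obtain ⟨rfl, -⟩ := pathGadget_adj_inr_inr.1 hab
        exact ⟨i, rfl⟩
    obtain ⟨f, hf, hne⟩ := Set.exists_ne_of_one_lt_ncard hedges s(v, x)
    induction f with
    | _ a b =>
      rcases exists_mem_of_isAcyclic_induce_compl_pathGadget hm hac hf with
        ⟨i, h'⟩ | ⟨i, h'⟩ | ⟨i, h'⟩ | ⟨i, h'⟩ <;> obtain ⟨j, hj⟩ := hall ⟨_, h'⟩ <;> grind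
  have hne : S.Nonempty := by
    obtain ⟨f, hf⟩ := Set.nonempty_of_ncard_ne_zero (show G.edgeSet.ncard ≠ 0 by omega)
    induction f with
    | _ a b => exact (hcover a b hf).elim (fun h => ⟨a, h⟩) (fun h => ⟨b, h⟩)
  let H : SimpleGraph S := SimpleGraph.fromRel fun a b =>
    ∃ h : G.Adj a b, ∀ j, Sum.inr (⟨(a.1, b.1), h⟩, j) ∈ S'
  have hHle : H ≤ G.induce S := by
    intro a b hab
    rcases (fromRel_adj _ _ _).1 hab with ⟨-, ⟨h, -⟩ | ⟨h, -⟩⟩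
    · exact h
    · exact h.symm
  obtain ⟨r⟩ := hne.to_subtype
  have hHadj : ∀ (e : {p : V × V // G.Adj p.1 p.2}) (h₁ : e.1.1 ∈ S) (h₂ : e.1.2 ∈ S),
      (∀ j, Sum.inr (e, j) ∈ S') → H.Adj ⟨_, h₁⟩ ⟨_, h₂⟩ := fun e h₁ h₂ h =>
    (fromRel_adj _ _ _).2 ⟨fun h => e.2.ne (congrArg Subtype.val h), Or.inl ⟨e.2, h⟩⟩
  have hHreach : ∀ v, H.Reachable r v := by
    rintro ⟨v, k, hk⟩
    obtain ⟨l, hl⟩ := r.2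
    let P : S' → Prop := fun w => Sum.elim (fun p => ∃ h : p.1 ∈ S, H.Reachable r ⟨p.1, h⟩)
      (fun q => (∃ h : q.1.1.1 ∈ S, H.Reachable r ⟨_, h⟩ ∧ ∀ j ≤ q.2, Sum.inr (q.1, j) ∈ S') ∨
        (∃ h : q.1.1.2 ∈ S, H.Reachable r ⟨_, h⟩ ∧ ∀ j, q.2 ≤ j → Sum.inr (q.1, j) ∈ S')) w.1
    have hP : ∀ a b, ((pathGadget G nu m).induce S').Adj a b → P a → P b := by
      rintro ⟨⟨u, a⟩ | ⟨e, a⟩, ha⟩ ⟨⟨v, b⟩ | ⟨f, b⟩, hb⟩ hab hPa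
      · obtain ⟨rfl, -⟩ := pathGadget_adj_inl_inl.1 hab
        exact hPa
      · rcases pathGadget_adj_inl_inr.1 hab with ⟨rfl, -, h0⟩ | ⟨rfl, -, h0⟩
        · refine Or.inl ⟨hPa.1, hPa.2, fun j hj => ?_⟩
          obtain rfl : j = b := Fin.ext (by have : (j : ℕ) ≤ b := hj; omega)
          exact hb
        · refine Or.inr ⟨hPa.1, hPa.2, fun j hj => ?_⟩
          obtain rfl : j = b := Fin.ext (by have : (b : ℕ) ≤ j := hj; omega)
          exact hb
      · rcases pathGadget_adj_inr_inl.1 hab with ⟨rfl, -, h0⟩ | ⟨rfl, -, h0⟩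
        · rcases hPa with ⟨h, hr, -⟩ | ⟨h, hr, hj⟩
          · exact ⟨h, hr⟩
          · exact ⟨⟨b, hb⟩, hr.trans
              (hHadj e ⟨b, hb⟩ h fun j => hj j (Fin.le_def.2 (by simp only; omega))).symm.reachable⟩
        · rcases hPa with ⟨h, hr, hj⟩ | ⟨h, hr, -⟩
          · exact ⟨⟨b, hb⟩, hr.trans
              (hHadj e h ⟨b, hb⟩ fun j => hj j (Fin.le_def.2 (by simp only; omega))).reachable⟩
          · exact ⟨h, hr⟩
      · obtain ⟨rfl, h0⟩ := pathGadget_adj_inr_inr.1 hab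
        rcases hPa with ⟨h, hr, hj⟩ | ⟨h, hr, hj⟩
        · refine Or.inl ⟨h, hr, fun j hjb => ?_⟩
          by_cases hjb' : j = b
          · exact hjb' ▸ hb
          · exact hj j (Fin.le_def.2 (by simp only [Fin.le_def] at hjb ⊢; omega))
        · refine Or.inr ⟨h, hr, fun j hjb => ?_⟩
          by_cases hjb' : j = b
          · exact hjb' ▸ hb
          · exact hj j (Fin.le_def.2 (by simp only [Fin.le_def] at hjb ⊢; omega))
    exact ((hconn ⟨_, hl⟩ ⟨_, hk⟩).of_adj_closed hP ⟨r.2, Reachable.refl _⟩).2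
  have hHconn : H.Connected := (connected_iff_exists_forall_reachable _).2 ⟨r, hHreach⟩
  refine ⟨S, hcover, hHconn.mono hHle, ?_⟩
  have hcard := hHconn.card_vert_le_card_edgeSet_add_one
  have horient : ∀ f : H.edgeSet, ∃ e : {p : V × V // G.Adj p.1 p.2},
      Sym2.map Subtype.val f.1 = s(e.1.1, e.1.2) ∧ ∀ j, Sum.inr (e, j) ∈ S' := by
    rintro ⟨f, hf⟩
    induction f with
    | _ a b =>
      rcases (fromRel_adj _ _ _).1 ((mem_edgeSet _).1 hf) with ⟨-, ⟨h, h'⟩ | ⟨h, h'⟩⟩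
      · exact ⟨_, rfl, h'⟩
      · exact ⟨⟨(b.1, a.1), h⟩, Sym2.eq_swap, h'⟩
  choose e he hemem using horient
  have hinj : Function.Injective fun x : H.edgeSet × Fin m =>
      (⟨Sum.inr (e x.1, x.2), hemem x.1 x.2⟩ : S') := by
    rintro ⟨f, i⟩ ⟨g, j⟩ hfg
    simp only [Subtype.mk.injEq, Sum.inr.injEq, Prod.mk.injEq] at hfg
    obtain ⟨hfg, rfl⟩ := hfg
    have := (he f).trans (hfg ▸ (he g).symm)
    rw [Subtype.ext (Sym2.map.injective Subtype.val_injective this)]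
  have hle := Nat.card_le_card_of_injective _ hinj
  rw [Nat.card_prod, Nat.card_fin, Nat.card_coe_set_eq S'] at hle
  rw [Nat.card_coe_set_eq] at hcard
  calc m * (S.ncard - 1) ≤ m * Nat.card H.edgeSet := Nat.mul_le_mul_left _ (by omega)
    _ ≤ S'.ncard := by rw [mul_comm]; exact hle

end PathGadget

end SimpleGraph

/-- The path-gadget reduction from connected vertex cover to connected feedback vertex
set: let `G` be a connected finite simple graph on `n` vertices with maximum degree at
most four and at least two edges, and fix an injective numbering `nu v` of the
neighbors of each vertex `v` into `{1,2,3,4}` (here `Fin 4`, zero-indexed).  The graph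
`G'` consists of a path `P(v) = v₁⋯v₈` on eight new vertices for every vertex `v`
(zero-indexed by `Fin 8`), a path `P(vx) = e¹_{vx}⋯e^{8n}_{vx}` on `8n` new vertices for
every ordered pair `(v,x)` of adjacent vertices (zero-indexed by `Fin (8n)`), together
with the edges `v_{2i-1} e¹_{vx}` and `v_{2i} e^{8n}_{xv}` where `i = nu v x`
(one-indexed; zero-indexed these are `v_{2·nu v x}` and `v_{2·nu v x + 1}`).  Then for
every `k` with `1 ≤ k < n`, `G` has a connected vertex cover of cardinality at most `k`
iff `G'` has a connected feedback vertex set of cardinality at most `8k + 8n(k-1)`. -/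
theorem stmt_15 {V : Type*} [Fintype V] [DecidableEq V]
    (G : SimpleGraph V) [DecidableRel G.Adj]
    (hconn : G.Connected)
    (hdeg : ∀ v : V, G.degree v ≤ 4)
    (hedges : 2 ≤ G.edgeSet.ncard)
    (n : ℕ) (hn : n = Fintype.card V)
    (nu : ∀ v : V, {x : V // G.Adj v x} → Fin 4)
    (hnu : ∀ v : V, Function.Injective (nu v))
    (k : ℕ) (hk1 : 1 ≤ k) (hkn : k < n) :
    let W := (V × Fin 8) ⊕ ({p : V × V // G.Adj p.1 p.2} × Fin (8 * n))
    let G' : SimpleGraph W := SimpleGraph.fromRel (fun a b =>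
      (∃ (v : V) (i j : Fin 8),
        a = Sum.inl (v, i) ∧ b = Sum.inl (v, j) ∧ (j : ℕ) = (i : ℕ) + 1) ∨
      (∃ (e : {p : V × V // G.Adj p.1 p.2}) (i j : Fin (8 * n)),
        a = Sum.inr (e, i) ∧ b = Sum.inr (e, j) ∧ (j : ℕ) = (i : ℕ) + 1) ∨
      (∃ (v x : V) (h : G.Adj v x) (i : Fin 8) (j : Fin (8 * n)),
        a = Sum.inl (v, i) ∧ b = Sum.inr (⟨(v, x), h⟩, j) ∧
        (i : ℕ) = 2 * (nu v ⟨x, h⟩ : ℕ) ∧ (j : ℕ) = 0) ∨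
      (∃ (v x : V) (h : G.Adj x v) (i : Fin 8) (j : Fin (8 * n)),
        a = Sum.inl (v, i) ∧ b = Sum.inr (⟨(x, v), h⟩, j) ∧
        (i : ℕ) = 2 * (nu v ⟨x, h.symm⟩ : ℕ) + 1 ∧ (j : ℕ) = 8 * n - 1))
    ((∃ S : Set V,
        (∀ u v : V, G.Adj u v → u ∈ S ∨ v ∈ S) ∧
        (G.induce S).Connected ∧ S.ncard ≤ k) ↔
      (∃ S' : Set W,
        (G'.induce S'ᶜ).IsAcyclic ∧
        (G'.induce S').Connected ∧ S'.ncard ≤ 8 * k + 8 * n * (k - 1))) := by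
  intro W G'
  have hm : 0 < 8 * n := by omega
  have hG' : G' = SimpleGraph.pathGadget G nu (8 * n) := rfl
  rw [hG']
  constructor
  · rintro ⟨S, hcover, hS, hcard⟩
    obtain ⟨S', hac, hS', hle⟩ := SimpleGraph.exists_connected_feedback_vertex_set hm hcover hS
    exact ⟨S', hac, hS', hle.trans (add_le_add (Nat.mul_le_mul_left _ hcard)
      (Nat.mul_le_mul_left _ (Nat.sub_le_sub_right hcard 1)))⟩
  · rintro ⟨S', hac, hS', hle⟩
    obtain ⟨S, hcover, hS, hcard⟩ :=
      SimpleGraph.exists_connected_vertex_cover hm hedges hac hS'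
    refine ⟨S, hcover, hS, ?_⟩
    by_contra! hlt
    have h1 : 8 * n * k ≤ 8 * n * (S.ncard - 1) := Nat.mul_le_mul_left _ (by omega)
    obtain ⟨k, rfl⟩ := Nat.exists_eq_add_of_le' hk1
    rw [Nat.mul_add] at h1
    rw [Nat.add_sub_cancel] at hle
    omega
end

section
/- Let G be a connected finite simple cubic graph (every vertex has degree exactly three) on n vertices, and suppose G has at least one cycle. Let fvs(G) denote the minimum cardinality of a feedback vertex set of G and cvc(G) the minimum cardinality of a connected vertex cover of G. Then 2·fvs(G) = 2·cvc(G) − n + 2. -/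
namespace SimpleGraph

open Finset

variable {V : Type*}

/-- A graph without edges leaving `s` is a forest as soon as it induces one on `s`. -/
lemma IsAcyclic.of_induce {T : SimpleGraph V} {s : Set V} (hs : T.support ⊆ s)
    (h : (T.induce s).IsAcyclic) : T.IsAcyclic := by
  intro a w hw
  have hmem : ∀ x ∈ w.support, x ∈ s := by
    intro x hx
    obtain ⟨e, he, hxe⟩ := (Walk.mem_support_iff_exists_mem_edges_of_not_nil hw.not_nil).1 hx
    obtain ⟨y, rfl⟩ := hxe
    exact hs ⟨y, w.adj_of_mem_edges he⟩
  refine h (w.induce s hmem) ?_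
  rw [← Walk.isCycle_map_iff_of_injective (f := (Embedding.induce s).toHom)
    Subtype.val_injective, Walk.map_induce]
  exact hw

lemma Walk.support_subset_of_support_subset {T : SimpleGraph V} {s : Set V} {x y : V}
    (p : T.Walk x y) (hs : T.support ⊆ s) (hx : x ∈ s) : ∀ z ∈ p.support, z ∈ s := by
  induction p with
  | nil => simpa using hx
  | cons hadj p ih =>
    intro z hz
    rcases List.mem_cons.1 hz with rfl | hz
    exacts [hx, ih (hs ⟨_, hadj.symm⟩) z hz]

/-- If `v` is isolated, joining it to `u` only makes `v` reachable from the component of `u`. -/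
lemma not_reachable_sup_edge_of_isolated {T : SimpleGraph V} {u v w : V}
    (hv : ∀ x, ¬ T.Adj v x) (hw : w ≠ v) (huw : ¬ T.Reachable u w) :
    ¬ (T ⊔ edge v u).Reachable v w := by
  have key : ∀ {x y : V}, (T ⊔ edge v u).Walk x y →
      (x = v ∨ T.Reachable u x) → (y = v ∨ T.Reachable u y) := by
    intro x y p
    induction p with
    | nil => exact id
    | cons hadj p ih =>
      rename_i a b c
      intro hx
      apply ih
      rw [sup_adj, edge_adj] at hadj
      rcases hadj with hadj | ⟨⟨_, rfl⟩ | ⟨_, rfl⟩, _⟩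
      · rcases hx with rfl | hx
        · exact absurd hadj (hv _)
        · exact .inr (hx.trans hadj.reachable)
      · exact .inr .rfl
      · exact .inl rfl
  rintro ⟨p⟩
  rcases key p (.inl rfl) with h | h
  exacts [hw h, huw h]

lemma ncard_edgeSet_sup_edge [Fintype V] {T : SimpleGraph V} {u v : V} (h : ¬ T.Adj u v)
    (hne : u ≠ v) :
    (T ⊔ edge u v).edgeSet.ncard = T.edgeSet.ncard + 1 := by
  classical
  rw [← coe_edgeFinset, ← coe_edgeFinset, Set.ncard_coe_finset, Set.ncard_coe_finset,
    card_edgeFinset_sup_edge _ h hne]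

lemma ncard_edgeSet_induce_of_support_subset [Fintype V] {T : SimpleGraph V} {s : Set V}
    (hs : T.support ⊆ s) : (T.induce s).edgeSet.ncard = T.edgeSet.ncard := by
  classical
  rw [← coe_edgeFinset, ← coe_edgeFinset, Set.ncard_coe_finset, Set.ncard_coe_finset,
    card_edgeFinset_induce_of_support_subset hs]

section Counting

variable (G : SimpleGraph V) [DecidableRel G.Adj]

lemma card_interedges_eq_sum [Fintype V] [DecidableEq V] (A B : Finset V) :
    #(G.interedges A B) = ∑ a ∈ A, #(G.neighborFinset a ∩ B) := by
  rw [interedges_def, card_filter, sum_product]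
  refine sum_congr rfl fun a _ => ?_
  rw [← card_filter]
  congr 1
  ext b
  simp [and_comm]

lemma card_interedges_comm (A B : Finset V) : #(G.interedges A B) = #(G.interedges B A) :=
  have : Std.Symm G.Adj := ⟨fun _ _ h => h.symm⟩
  Rel.card_interedges_comm A B

lemma card_interedges_insert [Fintype V] [DecidableEq V] {S : Finset V} {v : V} (hv : v ∉ S) :
    #(G.interedges (insert v S) (insert v S)) =
      #(G.interedges S S) + 2 * #(G.neighborFinset v ∩ S) := by
  have h1 : #(G.interedges (insert v S) (insert v S)) =
      #(G.neighborFinset v ∩ insert v S) + #(G.interedges S (insert v S)) := by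
    rw [card_interedges_eq_sum, sum_insert hv, card_interedges_eq_sum]
  have h2 : #(G.interedges S (insert v S)) = #(G.interedges (insert v S) S) :=
    G.card_interedges_comm _ _
  have h3 : #(G.interedges (insert v S) S) =
      #(G.neighborFinset v ∩ S) + #(G.interedges S S) := by
    rw [card_interedges_eq_sum, sum_insert hv, card_interedges_eq_sum]
  have h4 : G.neighborFinset v ∩ insert v S = G.neighborFinset v ∩ S :=
    inter_insert_of_notMem (by simp)
  rw [h1, h2, h3, h4]
  ring

lemma two_mul_ncard_edgeSet_induce (S : Finset V) :
    2 * (G.induce (S : Set V)).edgeSet.ncard = #(G.interedges S S) := by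
  classical
  rw [← coe_edgeFinset, Set.ncard_coe_finset, two_mul_card_edgeFinset]
  refine card_bij (fun p _ => (p.1.1, p.2.1)) ?_ ?_ ?_
  · rintro ⟨⟨a, ha⟩, ⟨b, hb⟩⟩ h
    simpa [mk_mem_interedges_iff, mem_coe.1 ha, mem_coe.1 hb] using h
  · rintro ⟨⟨a, ha⟩, ⟨b, hb⟩⟩ _ ⟨⟨c, hc⟩, ⟨d, hd⟩⟩ _ h
    simpa using h
  · rintro ⟨a, b⟩ h
    rw [mk_mem_interedges_iff] at h
    exact ⟨(⟨a, h.1⟩, ⟨b, h.2.1⟩), by simpa using h.2.2, rfl⟩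

/-- In a cubic graph, a vertex cover `S` spans `3 * #S - 3 * n / 2` edges. -/
lemma card_interedges_add_of_isVertexCover [Fintype V] [DecidableEq V]
    (hcubic : ∀ v, G.degree v = 3) {S : Finset V}
    (hS : ∀ u v, G.Adj u v → u ∈ S ∨ v ∈ S) :
    #(G.interedges S S) + 3 * Fintype.card V = 6 * #S := by
  have hsplit : ∀ A : Finset V,
      3 * #A = #(G.interedges A S) + #(G.interedges A Sᶜ) := by
    intro A
    rw [card_interedges_eq_sum, card_interedges_eq_sum, ← sum_add_distrib]
    rw [mul_comm, ← smul_eq_mul, ← sum_const]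
    refine sum_congr rfl fun a _ => ?_
    rw [← hcubic a, ← card_neighborFinset_eq_degree, ← sdiff_eq_inter_compl,
      card_inter_add_card_sdiff]
  have h1 := hsplit S
  have h2 := hsplit Sᶜ
  have h3 : #(G.interedges Sᶜ S) = #(G.interedges S Sᶜ) := G.card_interedges_comm _ _
  have h4 : #(G.interedges Sᶜ Sᶜ) = 0 := by
    rw [card_eq_zero, eq_empty_iff_forall_notMem]
    rintro ⟨a, b⟩ h
    simp only [mk_mem_interedges_iff, mem_compl] at h
    rcases hS a b h.2.2 with h' | h' <;> tauto
  have h5 := card_add_card_compl S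
  omega

end Counting

/-- Deleting one endpoint of every edge outside a spanning tree leaves a forest. -/
lemma Connected.exists_isAcyclic_induce_compl {W : Type*} [Fintype W] {H : SimpleGraph W}
    (hH : H.Connected) :
    ∃ F : Finset W, (H.induce (F : Set W)ᶜ).IsAcyclic ∧
      #F + Fintype.card W ≤ H.edgeSet.ncard + 1 := by
  classical
  obtain ⟨T, hT, hTree⟩ := hH.exists_isTree_le
  refine ⟨(H.edgeFinset \ T.edgeFinset).image fun e => e.out.1, ?_, ?_⟩
  · refine hTree.isAcyclic.comap ⟨Subtype.val, ?_⟩ Subtype.val_injective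
    rintro ⟨a, ha⟩ ⟨b, hb⟩ hab
    by_contra hnot
    have hmem : s(a, b) ∈ H.edgeFinset \ T.edgeFinset := by
      simpa using ⟨hab, hnot⟩
    have hout := mem_image_of_mem (fun e : Sym2 W => e.out.1) hmem
    rcases Sym2.mem_iff.1 (Sym2.out_fst_mem s(a, b)) with h | h
    · exact ha (by rw [mem_coe]; simpa only [h] using hout)
    · exact hb (by rw [mem_coe]; simpa only [h] using hout)
  · have h1 := card_image_le (s := H.edgeFinset \ T.edgeFinset) (f := fun e => e.out.1)
    have h2 := card_sdiff_add_card_eq_card (edgeFinset_mono hT)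
    have h3 := hTree.card_edgeFinset
    rw [← coe_edgeFinset, Set.ncard_coe_finset]
    omega

lemma exists_feedbackVertexSet_of_connected_vertexCover [Fintype V] [DecidableEq V]
    (G : SimpleGraph V) [DecidableRel G.Adj] (hcubic : ∀ v, G.degree v = 3) {S : Finset V}
    (hcover : ∀ u v, G.Adj u v → u ∈ S ∨ v ∈ S) (hconn : (G.induce (S : Set V)).Connected) :
    ∃ F : Finset V, (G.induce (F : Set V)ᶜ).IsAcyclic ∧ 2 * #F + Fintype.card V ≤ 2 * #S + 2 := by
  classical
  obtain ⟨F, hF, hcard⟩ := hconn.exists_isAcyclic_induce_compl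
  refine ⟨F.map (Function.Embedding.subtype _) ∪ Sᶜ, ?_, ?_⟩
  · have hmem : ∀ x : ((F.map (Function.Embedding.subtype _) ∪ Sᶜ : Finset V) : Set V)ᶜ.Elem,
        ∃ h : (x : V) ∈ (S : Set V), (⟨x, h⟩ : (S : Set V)) ∉ F := by
      rintro ⟨x, hx⟩
      simp only [Set.mem_compl_iff, mem_coe, mem_union, mem_map, mem_compl, not_or, not_not] at hx
      exact ⟨hx.2, fun h => hx.1 ⟨_, h, rfl⟩⟩
    refine hF.comap ⟨fun x => ⟨⟨x, (hmem x).1⟩, (hmem x).2⟩, fun h => h⟩ ?_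
    intro x y hxy
    have hval := congrArg Subtype.val (congrArg Subtype.val hxy)
    exact Subtype.ext hval
  · have h1 := card_union_le (F.map (Function.Embedding.subtype _)) Sᶜ
    have h2 := G.two_mul_ncard_edgeSet_induce S
    have h3 := G.card_interedges_add_of_isVertexCover hcubic hcover
    have h4 := card_add_card_compl S
    have h5 : Fintype.card (S : Set V) = #S := by simp
    rw [card_map] at h1
    omega

/-- `T` is a forest of edges of `G[S]`, and `G[S]` has at most `|T| + |S| - c / 2` edges. -/
structure IsLargeForest (G : SimpleGraph V) [DecidableRel G.Adj] (c : ℕ) (S : Finset V)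
    (T : SimpleGraph V) : Prop where
  le : T ≤ G
  isAcyclic : T.IsAcyclic
  mem : ∀ ⦃u v⦄, T.Adj u v → u ∈ S
  card_le : #(G.interedges S S) + c ≤ 2 * T.edgeSet.ncard + 2 * #S

namespace IsLargeForest

variable {G : SimpleGraph V} [DecidableRel G.Adj] {c : ℕ} {S : Finset V} {T : SimpleGraph V}

lemma not_reachable (h : IsLargeForest G c S T) {u v : V} (hv : v ∉ S) (huv : u ≠ v) :
    ¬ T.Reachable v u := by
  rintro ⟨p⟩
  cases p with
  | nil => exact huv rfl
  | cons hadj _ => exact hv (h.mem hadj)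

lemma sup_edge [Fintype V] (h : IsLargeForest G c S T) {u v : V} (hu : u ∈ S) (hv : v ∈ S)
    (huv : G.Adj u v) (hnr : ¬ T.Reachable u v) :
    IsLargeForest G c S (T ⊔ edge u v) where
  le := sup_le h.le ((edge_le_iff _).2 (.inr huv))
  isAcyclic := h.isAcyclic.sup_edge_of_not_reachable hnr
  mem a b hab := by
    rw [sup_adj, edge_adj] at hab
    rcases hab with hab | ⟨⟨rfl, _⟩ | ⟨rfl, _⟩, _⟩
    exacts [h.mem hab, hu, hv]
  card_le := by
    rw [ncard_edgeSet_sup_edge (fun hadj => hnr hadj.reachable) huv.ne]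
    have := h.card_le
    omega

/-- Adding a vertex keeps the bound if enough edges at that vertex enter the forest. -/
lemma insert_of_le [Fintype V] [DecidableEq V] (h : IsLargeForest G c S T) {v : V} (hv : v ∉ S)
    {T' : SimpleGraph V}
    (hle : T' ≤ G) (hacyc : T'.IsAcyclic) (hmem : ∀ ⦃a b⦄, T'.Adj a b → a ∈ insert v S)
    (hcard : #(G.neighborFinset v ∩ S) + T.edgeSet.ncard ≤ T'.edgeSet.ncard + 1) :
    IsLargeForest G c (insert v S) T' where
  le := hle
  isAcyclic := hacyc
  mem := hmem
  card_le := by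
    rw [G.card_interedges_insert hv, card_insert_of_notMem hv]
    have := h.card_le
    omega

lemma exists_insert_of_adj [Fintype V] [DecidableEq V] (h : IsLargeForest G c S T)
    (hcubic : ∀ v, G.degree v = 3) {v w : V}
    (hv : v ∉ S) (hw : w ∉ S) (hvw : G.Adj v w) :
    ∃ T', IsLargeForest G c (insert v S) T' ∧ T.edgeSet.ncard ≤ T'.edgeSet.ncard := by
  have hlt : #(G.neighborFinset v ∩ S) < 3 := by
    rw [← hcubic v, ← card_neighborFinset_eq_degree]
    exact card_lt_card ⟨inter_subset_left,
      fun hsub => hw (mem_inter.1 (hsub ((G.mem_neighborFinset v w).2 hvw))).2⟩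
  rcases (G.neighborFinset v ∩ S).eq_empty_or_nonempty with hempty | ⟨u, hu⟩
  · refine ⟨T, h.insert_of_le hv h.le h.isAcyclic
      (fun a b hab => mem_insert_of_mem (h.mem hab)) ?_, le_rfl⟩
    rw [hempty, card_empty]
    omega
  · rw [mem_inter, mem_neighborFinset] at hu
    have hnr := h.not_reachable hv hu.1.ne'
    have hcard := ncard_edgeSet_sup_edge (fun hadj => hnr hadj.reachable) hu.1.ne
    refine ⟨T ⊔ edge v u, h.insert_of_le hv (sup_le h.le ((edge_le_iff _).2 (.inr hu.1)))
      (h.isAcyclic.sup_edge_of_not_reachable hnr) ?_ (by omega), by omega⟩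
    intro a b hab
    rw [sup_adj, edge_adj] at hab
    rcases hab with hab | ⟨⟨rfl, _⟩ | ⟨rfl, _⟩, _⟩
    exacts [mem_insert_of_mem (h.mem hab), mem_insert_self _ _, mem_insert_of_mem hu.2]

lemma exists_insert_of_not_reachable [Fintype V] [DecidableEq V] (h : IsLargeForest G c S T)
    (hcubic : ∀ v, G.degree v = 3)
    {u v w : V} (hv : v ∉ S) (hu : u ∈ S) (hw : w ∈ S) (hvu : G.Adj v u) (hvw : G.Adj v w)
    (hnr : ¬ T.Reachable u w) :
    ∃ T', IsLargeForest G c (insert v S) T' ∧ T.edgeSet.ncard ≤ T'.edgeSet.ncard := by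
  have hle : #(G.neighborFinset v ∩ S) ≤ 3 := by
    rw [← hcubic v, ← card_neighborFinset_eq_degree]
    exact card_le_card inter_subset_left
  have hnr1 := h.not_reachable hv hvu.ne'
  have hnr2 := not_reachable_sup_edge_of_isolated (fun x hx => hv (h.mem hx)) hvw.ne' hnr
  have hcard1 := ncard_edgeSet_sup_edge (fun hadj => hnr1 hadj.reachable) hvu.ne
  have hcard2 := ncard_edgeSet_sup_edge (fun hadj => hnr2 hadj.reachable) hvw.ne
  refine ⟨T ⊔ edge v u ⊔ edge v w, h.insert_of_le hv
    (sup_le (sup_le h.le ((edge_le_iff _).2 (.inr hvu))) ((edge_le_iff _).2 (.inr hvw)))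
    ((h.isAcyclic.sup_edge_of_not_reachable hnr1).sup_edge_of_not_reachable hnr2) ?_ (by omega),
    by omega⟩
  intro a b hab
  simp only [sup_adj, edge_adj] at hab
  rcases hab with (hab | ⟨⟨rfl, _⟩ | ⟨rfl, _⟩, _⟩) | ⟨⟨rfl, _⟩ | ⟨rfl, _⟩, _⟩
  exacts [mem_insert_of_mem (h.mem hab), mem_insert_self _ _, mem_insert_of_mem hu,
    mem_insert_self _ _, mem_insert_of_mem hw]

end IsLargeForest

/-- If `S` covers all edges and `T`-components cannot be merged through an edge of `G[S]` or a
vertex outside `S`, then all of `S` lies in one component of `T`. -/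
lemma Walk.reachable_of_vertexCover {G T : SimpleGraph V} {S : Finset V}
    (hcover : ∀ u v, G.Adj u v → u ∈ S ∨ v ∈ S)
    (hedge : ∀ u v, u ∈ S → v ∈ S → G.Adj u v → T.Reachable u v)
    (hvert : ∀ u v w, v ∉ S → G.Adj v u → G.Adj v w → T.Reachable u w)
    {x y : V} (p : G.Walk x y) (hy : y ∈ S) :
    (x ∈ S → T.Reachable x y) ∧ (x ∉ S → ∀ w, G.Adj x w → T.Reachable w y) := by
  induction p with
  | nil => exact ⟨fun _ => .rfl, fun h => absurd hy h⟩
  | @cons a b c hab p ih =>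
    obtain ⟨ih1, ih2⟩ := ih hy
    refine ⟨fun ha => ?_, fun ha w haw => ?_⟩
    · by_cases hb : b ∈ S
      · exact (hedge a b ha hb hab).trans (ih1 hb)
      · exact ih2 hb a hab.symm
    · exact (hvert w a b ha haw hab).trans (ih1 ((hcover a b hab).resolve_left ha))

lemma exists_connected_vertexCover_of_feedbackVertexSet [Fintype V] [DecidableEq V]
    (G : SimpleGraph V) [DecidableRel G.Adj] (hconn : G.Connected) (hcubic : ∀ v, G.degree v = 3) {F : Finset V}
    (hF : (G.induce (F : Set V)ᶜ).IsAcyclic) :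
    ∃ S : Finset V, (∀ u v, G.Adj u v → u ∈ S ∨ v ∈ S) ∧ (G.induce (S : Set V)).Connected ∧
      2 * #S + 2 ≤ 2 * #F + Fintype.card V := by
  classical
  have hsupp : (G.induce ((Fᶜ : Finset V) : Set V)).spanningCoe.support ⊆ (Fᶜ : Finset V) :=
    fun x ⟨y, hxy⟩ => Subgraph.mem_of_adj_spanningCoe _ hxy
  have hstart : IsLargeForest G (2 * #Fᶜ) Fᶜ (G.induce ((Fᶜ : Finset V) : Set V)).spanningCoe :=
    { le := G.spanningCoe_induce_le _
      isAcyclic := by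
        refine .of_induce hsupp ?_
        rw [induce_spanningCoe, coe_compl]
        exact hF
      mem := fun u v huv => mem_coe.1 (hsupp ⟨v, huv⟩)
      card_le := by
        rw [← two_mul_ncard_edgeSet_induce, ← ncard_edgeSet_induce_of_support_subset hsupp,
          induce_spanningCoe] }
  obtain ⟨⟨S, T⟩, hST, hmax⟩ := Set.exists_max_image
    {p : Finset V × SimpleGraph V | IsLargeForest G (2 * #Fᶜ) p.1 p.2}
    (fun p => #p.1 + p.2.edgeSet.ncard) (Set.toFinite _) ⟨(_, _), hstart⟩
  replace hST : IsLargeForest G (2 * #Fᶜ) S T := hST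
  replace hmax : ∀ S' T', IsLargeForest G (2 * #Fᶜ) S' T' →
      #S' + T'.edgeSet.ncard ≤ #S + T.edgeSet.ncard := fun S' T' h => hmax (S', T') h
  have hcover : ∀ u v, G.Adj u v → u ∈ S ∨ v ∈ S := by
    by_contra! ⟨u, v, huv, hu, hv⟩
    obtain ⟨T', hT', hle⟩ := hST.exists_insert_of_adj hcubic hu hv huv
    have := hmax _ _ hT'
    rw [card_insert_of_notMem hu] at this
    omega
  have hedge : ∀ u v, u ∈ S → v ∈ S → G.Adj u v → T.Reachable u v := by
    by_contra! ⟨u, v, hu, hv, huv, hnr⟩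
    have := hmax _ _ (hST.sup_edge hu hv huv hnr)
    rw [ncard_edgeSet_sup_edge (fun hadj => hnr hadj.reachable) huv.ne] at this
    omega
  have hvert : ∀ u v w, v ∉ S → G.Adj v u → G.Adj v w → T.Reachable u w := by
    by_contra! ⟨u, v, w, hv, hvu, hvw, hnr⟩
    obtain ⟨T', hT', hle⟩ := hST.exists_insert_of_not_reachable hcubic hv
      ((hcover v u hvu).resolve_left hv) ((hcover v w hvw).resolve_left hv) hvu hvw hnr
    have := hmax _ _ hT'
    rw [card_insert_of_notMem hv] at this
    omega
  have hreach : ∀ x ∈ S, ∀ y ∈ S, T.Reachable x y := by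
    intro x hx y hy
    obtain ⟨p⟩ := hconn.preconnected x y
    exact (p.reachable_of_vertexCover hcover hedge hvert hy).1 hx
  have hsupp' : T.support ⊆ (S : Set V) := fun x ⟨y, hxy⟩ => hST.mem hxy
  have hTconn : (T.induce (S : Set V)).Connected := by
    have hnonempty : Nonempty (S : Set V) := by
      obtain ⟨v⟩ := hconn.nonempty
      obtain ⟨w, hvw⟩ := (G.degree_pos_iff_exists_adj v).1 (by rw [hcubic]; norm_num)
      rcases hcover v w hvw with h | h
      exacts [⟨v, h⟩, ⟨w, h⟩]
    refine ⟨fun ⟨x, hx⟩ ⟨y, hy⟩ => ?_⟩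
    obtain ⟨p⟩ := hreach x hx y hy
    exact ⟨p.induce _ (p.support_subset_of_support_subset hsupp' hx)⟩
  refine ⟨S, hcover, hTconn.mono (comap_monotone _ hST.le), ?_⟩
  have h1 := (isTree_iff_connected_and_card.1 ⟨hTconn, hST.isAcyclic.induce _⟩).2
  rw [Nat.card_coe_set_eq, ncard_edgeSet_induce_of_support_subset hsupp', Nat.card_coe_set_eq,
    Set.ncard_coe_finset] at h1
  have h2 := hST.card_le
  have h3 := G.card_interedges_add_of_isVertexCover hcubic hcover
  have h4 := card_add_card_compl F
  omega

end SimpleGraph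


/-- Speckenmeyer's identity for connected cubic graphs with at least one cycle:
`fvs(G) = cvc(G) - n/2 + 1`, stated doubled over `ℤ` as
`2·fvs(G) = 2·cvc(G) - n + 2`, where `fvs(G)` is the minimum cardinality of a feedback
vertex set of `G` and `cvc(G)` is the minimum cardinality of a connected vertex cover
of `G`. -/
theorem stmt_17 {V : Type*} [Fintype V] [DecidableEq V]
    (G : SimpleGraph V) [DecidableRel G.Adj]
    (hconn : G.Connected)
    (hcubic : ∀ v : V, G.degree v = 3)
    (hcyc : ¬ G.IsAcyclic) :
    (2 : ℤ) * ((sInf {m : ℕ | ∃ S : Set V,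
        (G.induce Sᶜ).IsAcyclic ∧ S.ncard = m} : ℕ) : ℤ)
      = 2 * ((sInf {m : ℕ | ∃ S : Set V,
          (∀ u v : V, G.Adj u v → u ∈ S ∨ v ∈ S) ∧
          (G.induce S).Connected ∧ S.ncard = m} : ℕ) : ℤ)
        - (Fintype.card V : ℤ) + 2 := by
  have hvalF := Nat.sInf_mem (s := {m : ℕ | ∃ S : Set V,
      (G.induce Sᶜ).IsAcyclic ∧ S.ncard = m}) ⟨_, Set.univ, by
        rw [Set.compl_univ]
        exact .of_subsingleton, rfl⟩
  have hvalC := Nat.sInf_mem (s := {m : ℕ | ∃ S : Set V,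
      (∀ u v : V, G.Adj u v → u ∈ S ∨ v ∈ S) ∧
      (G.induce S).Connected ∧ S.ncard = m}) ⟨_, Set.univ, by simp,
        (SimpleGraph.induceUnivIso G).connected_iff.2 hconn, rfl⟩
  obtain ⟨F, hF, hFcard⟩ := hvalF
  obtain ⟨S, hcover, hS, hScard⟩ := hvalC
  lift F to Finset V using F.toFinite
  lift S to Finset V using S.toFinite
  obtain ⟨F', hF', hF'card⟩ :=
    G.exists_feedbackVertexSet_of_connected_vertexCover hcubic hcover hS
  obtain ⟨S', hcover', hS', hS'card⟩ :=
    G.exists_connected_vertexCover_of_feedbackVertexSet hconn hcubic hF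
  have h1 := Nat.sInf_le (s := {m : ℕ | ∃ S : Set V,
      (G.induce Sᶜ).IsAcyclic ∧ S.ncard = m}) ⟨F', hF', rfl⟩
  have h2 := Nat.sInf_le (s := {m : ℕ | ∃ S : Set V,
      (∀ u v : V, G.Adj u v → u ∈ S ∨ v ∈ S) ∧
      (G.induce S).Connected ∧ S.ncard = m}) ⟨S', hcover', hS', rfl⟩
  rw [Set.ncard_coe_finset] at hFcard hScard h1 h2
  omega
end
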